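/- arXiv:2307.14297 — 2 statements merged into one kernel-verified Lean document; each statement's English description precedes it below -/
import Mathlib

section
/- (Structured singular value with two full complex blocks.) Let M ∈ ℂ^{(n_v+n_e)×(n_w+n_d)} be partitioned as M = [[M₁₁, M₁₂],[M₂₁, M₂₂]] with M₁₁ ∈ ℂ^{n_v×n_w}, M₁₂ ∈ ℂ^{n_v×n_d}, M₂₁ ∈ ℂ^{n_e×n_w}, M₂₂ ∈ ℂ^{n_e×n_d}. The following are equivalent: (A) there exists a real scalar D > 0 such that σ̄(diag(D·I_{n_v}, I_{n_e}) · M · diag(D⁻¹·I_{n_w}, I_{n_d})) < 1; (B) for all Δ ∈ ℂ^{n_w×n_v} and Δ_P ∈ ℂ^{n_d×n_e}, if det(I − M·diag(Δ, Δ_P)) = 0 then max(σ̄(Δ), σ̄(Δ_P)) > 1; (C) for every Δ ∈ ℂ^{n_w×n_v} with σ̄(Δ) ≤ 1, the matrix I_{n_v} − M₁₁Δ is invertible and σ̄(M₂₂ + M₂₁Δ(I_{n_v} − M₁₁Δ)⁻¹M₁₂) < 1. -/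
open Matrix

noncomputable section

/-- Largest singular value (operator 2-norm) of a complex matrix. -/
def sigmaMax {k l : Type*} [Fintype k] [Fintype l] [DecidableEq k] [DecidableEq l]
    (M : Matrix k l ℂ) : ℝ :=
  ‖LinearMap.toContinuousLinearMap (Matrix.toEuclideanLin M)‖

set_option linter.unusedSectionVars false

/-- Sum of squared absolute values. -/
def SS {k : Type*} [Fintype k] (v : k → ℂ) : ℝ := ∑ i, ‖v i‖ ^ 2

section aux
variable {k l : Type*} [Fintype k] [Fintype l] [DecidableEq k] [DecidableEq l]

lemma SS_nonneg (v : k → ℂ) : 0 ≤ SS v := Finset.sum_nonneg fun _ _ => by positivity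

lemma SS_zero : SS (0 : k → ℂ) = 0 := by simp [SS]

lemma SS_eq_zero {v : k → ℂ} (h : SS v = 0) : v = 0 := by
  unfold SS at h
  rw [Finset.sum_eq_zero_iff_of_nonneg (fun _ _ => by positivity)] at h
  ext i
  simpa using h i (Finset.mem_univ i)

lemma SS_le_zero {v : k → ℂ} (h : SS v ≤ 0) : v = 0 := SS_eq_zero (le_antisymm h (SS_nonneg v))

lemma SS_smul (c : ℂ) (v : k → ℂ) : SS (c • v) = ‖c‖ ^ 2 * SS v := by
  simp [SS, Finset.mul_sum, mul_pow]

lemma SS_norm (v : k → ℂ) : ‖WithLp.toLp 2 v‖ ^ 2 = SS v := by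
  rw [EuclideanSpace.norm_sq_eq]; rfl

lemma SS_cont : Continuous (SS : (k → ℂ) → ℝ) := by
  unfold SS; fun_prop

lemma SS_comb (x y : k → ℂ) : ∃ c : ℝ, ∀ a b : ℝ,
    SS ((a : ℂ) • x + (b : ℂ) • y) = a ^ 2 * SS x + b ^ 2 * SS y + a * b * c := by
  refine ⟨∑ i, 2 * ((x i).re * (y i).re + (x i).im * (y i).im), fun a b => ?_⟩
  simp only [SS, Finset.mul_sum, ← Finset.sum_add_distrib]
  refine Finset.sum_congr rfl fun i _ => ?_
  simp only [← Complex.normSq_eq_norm_sq, Complex.normSq_apply]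
  simp
  ring

lemma s1 (M : Matrix k l ℂ) (x : l → ℂ) : SS (M *ᵥ x) ≤ sigmaMax M ^ 2 * SS x := by
  rw [← SS_norm, ← SS_norm, ← mul_pow]
  have := (LinearMap.toContinuousLinearMap (Matrix.toEuclideanLin M)).le_opNorm (WithLp.toLp 2 x)
  exact pow_le_pow_left₀ (norm_nonneg _) this 2

lemma sigma_nonneg (M : Matrix k l ℂ) : 0 ≤ sigmaMax M := norm_nonneg _

lemma s1' (M : Matrix k l ℂ) (h : sigmaMax M ≤ 1) (x : l → ℂ) : SS (M *ᵥ x) ≤ SS x := by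
  have h1 := s1 M x
  have h2 := SS_nonneg x
  have h3 : sigmaMax M ^ 2 ≤ 1 := pow_le_one₀ (sigma_nonneg M) h
  nlinarith

lemma s1'' (M : Matrix k l ℂ) (h : sigmaMax M < 1) (x : l → ℂ) (hx : x ≠ 0) :
    SS (M *ᵥ x) < SS x := by
  have h1 := s1 M x
  have h2 : 0 < SS x := lt_of_le_of_ne (SS_nonneg x) fun e => hx (SS_eq_zero e.symm)
  have h3 : sigmaMax M ^ 2 < 1 := pow_lt_one₀ (sigma_nonneg M) h (by norm_num)
  nlinarith

lemma s2 (M : Matrix k l ℂ) (h : ∀ x, SS (M *ᵥ x) ≤ SS x) : sigmaMax M ≤ 1 := by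
  refine ContinuousLinearMap.opNorm_le_bound _ zero_le_one fun x => ?_
  rw [one_mul]
  refine (pow_le_pow_iff_left₀ (norm_nonneg _) (norm_nonneg _) two_ne_zero).1 ?_
  have := h x.ofLp
  rw [← SS_norm, ← SS_norm] at this
  exact this

lemma s3 (M : Matrix k l ℂ) (h : ∀ x, x ≠ 0 → SS (M *ᵥ x) < SS x) : sigmaMax M < 1 := by
  set f := LinearMap.toContinuousLinearMap (Matrix.toEuclideanLin M) with hf
  have hlt : ∀ x, x ≠ 0 → ‖f x‖ < ‖x‖ := by
    intro x hx
    have := h x.ofLp (by simpa using hx)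
    rw [← SS_norm, ← SS_norm] at this
    exact lt_of_pow_lt_pow_left₀ 2 (norm_nonneg _) this
  by_cases hne : (Metric.sphere (0 : EuclideanSpace ℂ l) 1).Nonempty
  · obtain ⟨x0, hx0, hmax⟩ := (isCompact_sphere (0 : EuclideanSpace ℂ l) 1).exists_isMaxOn hne
      (f := fun x => ‖f x‖) (by fun_prop)
    have hx1 : ‖x0‖ = 1 := by simpa using hx0
    have h1 : ‖f x0‖ < 1 := by
      rw [← hx1]; exact hlt x0 (by intro e; simp [e] at hx1)
    refine lt_of_le_of_lt ?_ h1
    change ‖f‖ ≤ _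
    refine ContinuousLinearMap.opNorm_le_of_unit_norm (norm_nonneg _) fun x hx => ?_
    exact hmax (by simpa using hx)
  · have : ‖f‖ ≤ 0 := by
      refine ContinuousLinearMap.opNorm_le_of_unit_norm le_rfl fun x hx => ?_
      exact absurd ⟨x, by simpa using hx⟩ hne
    exact lt_of_le_of_lt this one_pos

lemma s4 (v : k → ℂ) (w : l → ℂ) (h : SS w ≤ SS v) :
    ∃ Δ : Matrix l k ℂ, sigmaMax Δ ≤ 1 ∧ Δ *ᵥ v = w := by
  by_cases hv : SS v = 0
  · have hv0 := SS_eq_zero hv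
    have hw0 : w = 0 := SS_le_zero (hv ▸ h)
    refine ⟨0, s2 _ fun x => ?_, by simp [hw0]⟩
    simpa [SS_zero] using SS_nonneg x
  have hpos : 0 < SS v := lt_of_le_of_ne (SS_nonneg v) (Ne.symm hv)
  have hmul : ∀ x, (((SS v : ℂ))⁻¹ • vecMulVec w (star v)) *ᵥ x
      = ((SS v : ℂ)⁻¹ * (star v ⬝ᵥ x)) • w := by
    intro x
    rw [Matrix.smul_mulVec, Matrix.vecMulVec_mulVec]
    ext i
    simp
    ring
  have hvv : star v ⬝ᵥ v = (SS v : ℂ) := by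
    simp only [SS, dotProduct, Pi.star_apply, Complex.ofReal_sum]
    refine Finset.sum_congr rfl fun i _ => ?_
    rw [mul_comm, RCLike.star_def, Complex.mul_conj, Complex.normSq_eq_norm_sq]
  have hCS : ∀ x, ‖star v ⬝ᵥ x‖ ^ 2 ≤ SS v * SS x := by
    intro x
    rw [← SS_norm, ← SS_norm, ← mul_pow]
    refine pow_le_pow_left₀ (norm_nonneg _) ?_ 2
    have := norm_inner_le_norm (𝕜 := ℂ) (WithLp.toLp 2 v) (WithLp.toLp 2 x)
    rwa [EuclideanSpace.inner_toLp_toLp, dotProduct_comm] at this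
  refine ⟨((SS v : ℂ))⁻¹ • vecMulVec w (star v), s2 _ fun x => ?_, ?_⟩
  · rw [hmul, SS_smul, norm_mul, mul_pow, norm_inv, Complex.norm_real, Real.norm_of_nonneg hpos.le]
    have h2 : ‖star v ⬝ᵥ x‖ ^ 2 * SS w ≤ (SS v * SS x) * SS v :=
      mul_le_mul (hCS x) h (SS_nonneg _) (mul_nonneg hpos.le (SS_nonneg _))
    rw [inv_pow, mul_assoc, inv_mul_le_iff₀ (by positivity)]
    nlinarith
  · rw [hmul, hvv, inv_mul_cancel₀ (by exact_mod_cast hv), one_smul]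

lemma det_iff (X : Matrix k k ℂ) : (1 - X).det = 0 ↔ ∃ z, z ≠ 0 ∧ X *ᵥ z = z := by
  rw [← Matrix.exists_mulVec_eq_zero_iff]
  simp only [Matrix.sub_mulVec, Matrix.one_mulVec, sub_eq_zero]
  exact exists_congr fun z => and_congr_right fun _ => eq_comm

lemma sig_small_iff (X : Matrix k l ℂ) :
    sigmaMax X < 1 ↔ ∀ Y : Matrix l k ℂ, sigmaMax Y ≤ 1 → (1 - X * Y).det ≠ 0 := by
  constructor
  · intro h Y hY hd
    obtain ⟨z, hz, e⟩ := (det_iff _).1 hd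
    rw [← Matrix.mulVec_mulVec] at e
    have h0 : Y *ᵥ z ≠ 0 := by
      intro h0; rw [h0, Matrix.mulVec_zero] at e; exact hz e.symm
    have h1 := s1'' X h _ h0
    have h2 := s1' Y hY z
    rw [e] at h1
    linarith
  · intro h
    refine s3 _ fun x hx => ?_
    by_contra! hc
    obtain ⟨Y, hY, e⟩ := s4 _ _ hc
    refine h Y hY ((det_iff _).2 ⟨X *ᵥ x, ?_, ?_⟩)
    · intro h0
      rw [h0, Matrix.mulVec_zero] at e; exact hx e.symm
    · rw [← Matrix.mulVec_mulVec, e]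

end aux

/-- strict S-lemma -/
lemma slemma {E : Type*} [NormedAddCommGroup E] [NormedSpace ℂ E] [ProperSpace E]
    (q1 q2 : E → ℝ) (c1 : Continuous q1) (c2 : Continuous q2)
    (p1 : ∀ x y, ∃ c : ℝ, ∀ a b : ℝ,
      q1 ((a : ℂ) • x + (b : ℂ) • y) = a ^ 2 * q1 x + b ^ 2 * q1 y + a * b * c)
    (p2 : ∀ x y, ∃ c : ℝ, ∀ a b : ℝ,
      q2 ((a : ℂ) • x + (b : ℂ) • y) = a ^ 2 * q2 x + b ^ 2 * q2 y + a * b * c)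
    (h : ∀ x, x ≠ 0 → q1 x ≤ 0 → q2 x ≤ 0 → False) :
    ∃ t : ℝ, 0 < t ∧ t < 1 ∧ ∀ x, x ≠ 0 → 0 < (1 - t) * q1 x + t * q2 x := by
  have hom1 : ∀ (a : ℝ) x, q1 ((a : ℂ) • x) = a ^ 2 * q1 x := by
    intro a x
    obtain ⟨c, hc⟩ := p1 x x
    simpa using hc a 0
  have hom2 : ∀ (a : ℝ) x, q2 ((a : ℂ) • x) = a ^ 2 * q2 x := by
    intro a x
    obtain ⟨c, hc⟩ := p2 x x
    simpa using hc a 0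
  by_contra! hcon
  let S : Set E := Metric.sphere 0 1
  let T : (E → ℝ) → Set ℝ := fun q => Prod.fst '' ((Set.Icc (0:ℝ) 1 ×ˢ S) ∩
    {p : ℝ × E | (1 - p.1) * q1 p.2 + p.1 * q2 p.2 ≤ 0 ∧ q p.2 ≤ 0})
  have hT : ∀ q, Continuous q → IsClosed (T q) := by
    intro q hq
    refine IsCompact.isClosed (IsCompact.image ?_ continuous_fst)
    refine (isCompact_Icc.prod (isCompact_sphere _ _)).inter_right ?_
    have a1 : Continuous fun p : ℝ × E => (1 - p.1) * q1 p.2 + p.1 * q2 p.2 := by fun_prop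
    have a2 : Continuous fun p : ℝ × E => q p.2 := by fun_prop
    exact (isClosed_le a1 continuous_const).inter (isClosed_le a2 continuous_const)
  have dich : ∀ t ∈ Set.Icc (0:ℝ) 1, ∀ x, (1 - t) * q1 x + t * q2 x ≤ 0 → q1 x ≤ 0 ∨ q2 x ≤ 0 := by
    intro t ht x hx
    by_contra! hh
    obtain ⟨ha, hb⟩ := hh
    rcases eq_or_lt_of_le ht.1 with h0 | h0
    · rw [← h0] at hx; simp at hx; linarith
    · have := mul_pos h0 hb
      have := mul_nonneg (sub_nonneg.2 ht.2) ha.le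
      linarith
  have hIoo : Set.Ioo (0:ℝ) 1 ⊆ T q1 ∪ T q2 := by
    intro t ht
    obtain ⟨x, hx, hq⟩ := hcon t ht.1 ht.2
    have hn : ‖x‖ ≠ 0 := by simpa using hx
    set u : E := ((‖x‖⁻¹ : ℝ) : ℂ) • x with hu
    have huS : u ∈ S := by
      simp [S, hu, norm_smul, hn]
    have hqu : (1 - t) * q1 u + t * q2 u ≤ 0 := by
      rw [hu, hom1, hom2]
      have : 0 ≤ (‖x‖⁻¹) ^ 2 := by positivity
      nlinarith
    have htI : t ∈ Set.Icc (0:ℝ) 1 := ⟨ht.1.le, ht.2.le⟩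
    rcases dich t htI u hqu with h1 | h1
    · exact Or.inl ⟨(t, u), ⟨⟨htI, huS⟩, hqu, h1⟩, rfl⟩
    · exact Or.inr ⟨(t, u), ⟨⟨htI, huS⟩, hqu, h1⟩, rfl⟩
  have hIcc : Set.Icc (0:ℝ) 1 ⊆ T q1 ∪ T q2 := by
    rw [← closure_Ioo (by norm_num : (0:ℝ) ≠ 1)]
    exact closure_minimal hIoo ((hT q1 c1).union (hT q2 c2))
  have h0 : (0:ℝ) ∈ T q1 := by
    rcases hIcc (by simp : (0:ℝ) ∈ Set.Icc (0:ℝ) 1) with h0 | h0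
    · exact h0
    · obtain ⟨⟨t, x⟩, ⟨hm, hq, -⟩, e⟩ := h0
      refine ⟨(t, x), ⟨hm, hq, ?_⟩, e⟩
      simp only at e
      subst e
      simpa using hq
  have h1 : (1:ℝ) ∈ T q2 := by
    rcases hIcc (by simp : (1:ℝ) ∈ Set.Icc (0:ℝ) 1) with h0 | h0
    · obtain ⟨⟨t, x⟩, ⟨hm, hq, -⟩, e⟩ := h0
      refine ⟨(t, x), ⟨hm, hq, ?_⟩, e⟩
      simp only at e
      subst e
      simpa using hq
    · exact h0
  obtain ⟨t, htI, ht1, ht2⟩ := isPreconnected_closed_iff.1 isPreconnected_Icc _ _ (hT q1 c1)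
    (hT q2 c2) hIcc ⟨0, by simp, h0⟩ ⟨1, by simp, h1⟩
  obtain ⟨⟨t', x⟩, ⟨⟨-, hxS⟩, hqx, hx1⟩, e⟩ := ht1
  simp only at e hqx hx1 hxS
  subst e
  obtain ⟨⟨t, y⟩, ⟨⟨-, hyS⟩, hqy, hy2⟩, e⟩ := ht2
  simp only at e hqy hy2 hyS
  subst e
  have hx0 : x ≠ 0 := by rintro rfl; simp [S] at hxS
  have hy0 : y ≠ 0 := by rintro rfl; simp [S] at hyS
  obtain ⟨d1, hd1⟩ := p1 x y
  obtain ⟨d2, hd2⟩ := p2 x y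
  -- choose a sign
  obtain ⟨σ, hσ1, hσ⟩ : ∃ σ : ℝ, σ ^ 2 = 1 ∧ σ * ((1 - t) * d1 + t * d2) ≤ 0 := by
    rcases le_total ((1 - t) * d1 + t * d2) 0 with hh | hh
    · exact ⟨1, by norm_num, by linarith⟩
    · exact ⟨-1, by norm_num, by linarith⟩
  let z : ℝ → E := fun s => (((1 - s : ℝ)) : ℂ) • x + ((s * σ : ℝ) : ℂ) • y
  have hz1 : ∀ s, q1 (z s) = (1 - s) ^ 2 * q1 x + (s * σ) ^ 2 * q1 y + (1 - s) * (s * σ) * d1 :=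
    fun s => hd1 _ _
  have hz2 : ∀ s, q2 (z s) = (1 - s) ^ 2 * q2 x + (s * σ) ^ 2 * q2 y + (1 - s) * (s * σ) * d2 :=
    fun s => hd2 _ _
  have hzc : Continuous z := by
    have hc : Continuous (fun r : ℝ => (r : ℂ)) := Complex.continuous_ofReal
    exact ((hc.comp (by fun_prop : Continuous fun s : ℝ => 1 - s)).smul continuous_const).add
      ((hc.comp (by fun_prop : Continuous fun s : ℝ => s * σ)).smul continuous_const)
  have hzq : ∀ s ∈ Set.Icc (0:ℝ) 1, (1 - t) * q1 (z s) + t * q2 (z s) ≤ 0 := by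
    intro s hs
    rw [hz1, hz2]
    have e1 := mul_nonneg (sq_nonneg (1 - s)) (neg_nonneg.2 hqx)
    have e2 := mul_nonneg (sq_nonneg s) (neg_nonneg.2 hqy)
    have e3 := mul_nonneg (mul_nonneg (sub_nonneg.2 hs.2) hs.1) (neg_nonneg.2 hσ)
    have e4 : (s * σ) ^ 2 = s ^ 2 := by rw [mul_pow, hσ1, mul_one]
    rw [e4]
    nlinarith
  obtain ⟨s, hs, hs1, hs2⟩ := isPreconnected_closed_iff.1
    (isPreconnected_Icc (a := (0:ℝ)) (b := 1)) {s | q1 (z s) ≤ 0} {s | q2 (z s) ≤ 0}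
    (isClosed_le (c1.comp hzc) continuous_const) (isClosed_le (c2.comp hzc) continuous_const)
    (fun s hs => dich t htI _ (hzq s hs))
    ⟨0, by simp, by simpa [hz1] using hx1⟩ ⟨1, by simp, by simpa [hz2, hσ1] using hy2⟩
  refine h (z s) ?_ hs1 hs2
  -- z s = 0 would make x, y real multiples of one another
  intro hz0
  by_cases hs0 : s = 0
  · subst hs0
    simp [z] at hz0
    exact hx0 hz0
  · have hσ0 : σ ≠ 0 := by rintro rfl; norm_num at hσ1
    have hsσ : ((s * σ : ℝ) : ℂ) ≠ 0 := by exact_mod_cast mul_ne_zero hs0 hσ0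
    have hy : y = ((-(s * σ)⁻¹ * (1 - s) : ℝ) : ℂ) • x := by
      have : ((s * σ : ℝ) : ℂ) • y = -((((1 - s : ℝ)) : ℂ) • x) := eq_neg_of_add_eq_zero_right hz0
      rw [← inv_smul_smul₀ hsσ y, this, ← neg_smul, smul_smul]
      congr 1
      push_cast
      ring
    have hy1 : q1 y ≤ 0 := by
      rw [hy, hom1]
      exact mul_nonpos_of_nonneg_of_nonpos (sq_nonneg _) hx1
    exact h y hy0 hy1 hy2

lemma SS_sum {k l : Type*} [Fintype k] [Fintype l] (v : k ⊕ l → ℂ) :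
    SS v = SS (v ∘ Sum.inl) + SS (v ∘ Sum.inr) := by
  simp [SS]

lemma q_comb {k l m : Type*} [Fintype k] [Fintype l] [Fintype m]
    [DecidableEq l] [DecidableEq m]
    (P : Matrix l k ℂ) (Q : Matrix m k ℂ) (x y : k → ℂ) : ∃ c : ℝ, ∀ a b : ℝ,
    SS (P *ᵥ ((a : ℂ) • x + (b : ℂ) • y)) - SS (Q *ᵥ ((a : ℂ) • x + (b : ℂ) • y))
      = a ^ 2 * (SS (P *ᵥ x) - SS (Q *ᵥ x)) + b ^ 2 * (SS (P *ᵥ y) - SS (Q *ᵥ y)) + a * b * c := by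
  obtain ⟨c, hc⟩ := SS_comb (P *ᵥ x) (P *ᵥ y)
  obtain ⟨d, hd⟩ := SS_comb (Q *ᵥ x) (Q *ᵥ y)
  refine ⟨c - d, fun a b => ?_⟩
  rw [Matrix.mulVec_add, Matrix.mulVec_add, Matrix.mulVec_smul, Matrix.mulVec_smul,
    Matrix.mulVec_smul, Matrix.mulVec_smul, hc, hd]
  ring

section core
variable {v e w d : Type*} [Fintype v] [Fintype e] [Fintype w] [Fintype d]
  [DecidableEq v] [DecidableEq e] [DecidableEq w] [DecidableEq d]
  (M11 : Matrix v w ℂ) (M12 : Matrix v d ℂ) (M21 : Matrix e w ℂ) (M22 : Matrix e d ℂ)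

/-- vector form of (B) -/
def VB : Prop := ∀ (x : w → ℂ) (y : d → ℂ), SS x ≤ SS (M11 *ᵥ x + M12 *ᵥ y) →
  SS y ≤ SS (M21 *ᵥ x + M22 *ᵥ y) → x = 0 ∧ y = 0

lemma B_iff_VB :
    (∀ (Δ : Matrix w v ℂ) (ΔP : Matrix d e ℂ),
        (1 - Matrix.fromBlocks M11 M12 M21 M22 * Matrix.fromBlocks Δ 0 0 ΔP).det = 0 →
        1 < max (sigmaMax Δ) (sigmaMax ΔP)) ↔ VB M11 M12 M21 M22 := by
  constructor
  · intro h x y hx hy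
    obtain ⟨Δ, hΔ, e1⟩ := s4 _ _ hx
    obtain ⟨ΔP, hΔP, e2⟩ := s4 _ _ hy
    by_contra hne
    refine absurd (h Δ ΔP ((det_iff _).2
      ⟨Sum.elim (M11 *ᵥ x + M12 *ᵥ y) (M21 *ᵥ x + M22 *ᵥ y), ?_, ?_⟩))
      (not_lt.2 (max_le hΔ hΔP))
    · intro h0
      apply hne
      have a1 : M11 *ᵥ x + M12 *ᵥ y = 0 := by
        ext i; simpa using congrFun h0 (Sum.inl i)
      have a2 : M21 *ᵥ x + M22 *ᵥ y = 0 := by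
        ext i; simpa using congrFun h0 (Sum.inr i)
      rw [a1, Matrix.mulVec_zero] at e1
      rw [a2, Matrix.mulVec_zero] at e2
      exact ⟨e1.symm, e2.symm⟩
    · rw [← Matrix.mulVec_mulVec, Matrix.fromBlocks_mulVec, Matrix.fromBlocks_mulVec]
      simp [e1, e2]
  · intro h Δ ΔP hd
    by_contra! hc
    obtain ⟨h1, h2⟩ := max_le_iff.1 hc
    obtain ⟨z, hz, ez⟩ := (det_iff _).1 hd
    rw [← Matrix.mulVec_mulVec, Matrix.fromBlocks_mulVec, Matrix.fromBlocks_mulVec] at ez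
    simp only [Sum.elim_comp_inl, Sum.elim_comp_inr, Matrix.zero_mulVec, add_zero, zero_add] at ez
    have a1 : M11 *ᵥ (Δ *ᵥ (z ∘ Sum.inl)) + M12 *ᵥ (ΔP *ᵥ (z ∘ Sum.inr)) = z ∘ Sum.inl := by
      ext i; simpa using congrFun ez (Sum.inl i)
    have a2 : M21 *ᵥ (Δ *ᵥ (z ∘ Sum.inl)) + M22 *ᵥ (ΔP *ᵥ (z ∘ Sum.inr)) = z ∘ Sum.inr := by
      ext i; simpa using congrFun ez (Sum.inr i)
    obtain ⟨b1, b2⟩ := h (Δ *ᵥ (z ∘ Sum.inl)) (ΔP *ᵥ (z ∘ Sum.inr))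
      (by rw [a1]; exact s1' _ h1 _) (by rw [a2]; exact s1' _ h2 _)
    rw [b1, b2] at ez
    apply hz
    rw [← ez]
    ext i
    cases i <;> simp

lemma A_iff_VB : (∃ D : ℝ, 0 < D ∧
        sigmaMax
          (Matrix.fromBlocks ((D : ℂ) • (1 : Matrix v v ℂ)) 0 0 (1 : Matrix e e ℂ) *
            Matrix.fromBlocks M11 M12 M21 M22 *
            Matrix.fromBlocks (((D⁻¹ : ℝ) : ℂ) • (1 : Matrix w w ℂ)) 0 0
              (1 : Matrix d d ℂ)) < 1) ↔ VB M11 M12 M21 M22 := by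
  have key : ∀ D : ℝ, 0 < D → ∀ (x : w → ℂ) (y : d → ℂ),
      SS ((Matrix.fromBlocks ((D : ℂ) • (1 : Matrix v v ℂ)) 0 0 (1 : Matrix e e ℂ) *
            Matrix.fromBlocks M11 M12 M21 M22 *
            Matrix.fromBlocks (((D⁻¹ : ℝ) : ℂ) • (1 : Matrix w w ℂ)) 0 0
              (1 : Matrix d d ℂ)) *ᵥ (Sum.elim ((D : ℂ) • x) y)) =
      D ^ 2 * SS (M11 *ᵥ x + M12 *ᵥ y) + SS (M21 *ᵥ x + M22 *ᵥ y) := by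
    intro D hD x y
    have hD' : (D : ℂ) ≠ 0 := by exact_mod_cast hD.ne'
    rw [← Matrix.mulVec_mulVec, ← Matrix.mulVec_mulVec, Matrix.fromBlocks_mulVec,
      Matrix.fromBlocks_mulVec, Matrix.fromBlocks_mulVec, SS_sum]
    simp only [Sum.elim_comp_inl, Sum.elim_comp_inr, Matrix.zero_mulVec, add_zero, zero_add,
      Matrix.smul_mulVec, Matrix.one_mulVec]
    rw [SS_smul, smul_smul, Complex.ofReal_inv, inv_mul_cancel₀ hD', one_smul,
      Complex.norm_real, Real.norm_of_nonneg hD.le]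
  have key2 : ∀ D : ℝ, 0 < D → ∀ (x : w → ℂ) (y : d → ℂ),
      SS (Sum.elim ((D : ℂ) • x) y) = D ^ 2 * SS x + SS y := by
    intro D hD x y
    rw [SS_sum, Sum.elim_comp_inl, Sum.elim_comp_inr, SS_smul, Complex.norm_real,
      Real.norm_of_nonneg hD.le]
  constructor
  · rintro ⟨D, hD, hs⟩ x y hx hy
    have hD' : (D : ℂ) ≠ 0 := by exact_mod_cast hD.ne'
    by_contra hne
    have := s1'' _ hs (Sum.elim ((D : ℂ) • x) y) (by
      intro h0
      apply hne
      constructor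
      · ext i; simpa [hD'] using congrFun h0 (Sum.inl i)
      · ext i; simpa using congrFun h0 (Sum.inr i))
    rw [key D hD, key2 D hD] at this
    have := mul_le_mul_of_nonneg_left hx (sq_nonneg D)
    linarith
  · intro h
    let P1 : Matrix w (w ⊕ d) ℂ := Matrix.fromCols 1 0
    let P2 : Matrix d (w ⊕ d) ℂ := Matrix.fromCols 0 1
    let Q1 : Matrix v (w ⊕ d) ℂ := Matrix.fromCols M11 M12
    let Q2 : Matrix e (w ⊕ d) ℂ := Matrix.fromCols M21 M22
    have hP1 : ∀ x y, P1 *ᵥ (Sum.elim x y) = x := fun x y => by simp [P1, Matrix.fromCols_mulVec]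
    have hP2 : ∀ x y, P2 *ᵥ (Sum.elim x y) = y := fun x y => by simp [P2, Matrix.fromCols_mulVec]
    have hQ1 : ∀ x y, Q1 *ᵥ (Sum.elim x y) = M11 *ᵥ x + M12 *ᵥ y :=
      fun x y => by simp [Q1, Matrix.fromCols_mulVec]
    have hQ2 : ∀ x y, Q2 *ᵥ (Sum.elim x y) = M21 *ᵥ x + M22 *ᵥ y :=
      fun x y => by simp [Q2, Matrix.fromCols_mulVec]
    obtain ⟨t, ht0, ht1, ht⟩ := slemma (E := w ⊕ d → ℂ)
      (fun z => SS (P1 *ᵥ z) - SS (Q1 *ᵥ z)) (fun z => SS (P2 *ᵥ z) - SS (Q2 *ᵥ z))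
      ((SS_cont.comp (Continuous.matrix_mulVec continuous_const continuous_id)).sub
        (SS_cont.comp (Continuous.matrix_mulVec continuous_const continuous_id)))
      ((SS_cont.comp (Continuous.matrix_mulVec continuous_const continuous_id)).sub
        (SS_cont.comp (Continuous.matrix_mulVec continuous_const continuous_id)))
      (q_comb P1 Q1) (q_comb P2 Q2) (by
        intro z hz h1 h2
        rw [← Sum.elim_comp_inl_inr z] at h1 h2
        rw [hP1, hQ1] at h1
        rw [hP2, hQ2] at h2
        obtain ⟨b1, b2⟩ := h _ _ (sub_nonpos.1 h1) (sub_nonpos.1 h2)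
        apply hz
        rw [← Sum.elim_comp_inl_inr z, b1, b2]
        ext i; cases i <;> rfl)
    have hr : 0 < (1 - t) / t := div_pos (sub_pos.2 ht1) ht0
    have hD : 0 < √((1 - t) / t) := Real.sqrt_pos.2 hr
    refine ⟨√((1 - t) / t), hD, s3 _ fun z hz => ?_⟩
    set D := √((1 - t) / t) with hDdef
    have hDsq : D ^ 2 = (1 - t) / t := Real.sq_sqrt hr.le
    have hD' : (D : ℂ) ≠ 0 := by exact_mod_cast hD.ne'
    have hzz : z = Sum.elim ((D : ℂ) • ((D : ℂ)⁻¹ • (z ∘ Sum.inl))) (z ∘ Sum.inr) := by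
      rw [smul_inv_smul₀ hD', Sum.elim_comp_inl_inr]
    generalize (D : ℂ)⁻¹ • (z ∘ Sum.inl) = x at hzz
    generalize z ∘ Sum.inr = y at hzz
    subst hzz
    rw [key D hD, key2 D hD, hDsq]
    have hlt := ht (Sum.elim x y) (by
      intro h0
      apply hz
      have b1 : x = 0 := by ext i; exact congrFun h0 (Sum.inl i)
      have b2 : y = 0 := by ext i; exact congrFun h0 (Sum.inr i)
      rw [b1, b2]
      ext i; cases i <;> simp)
    simp only [hP1, hP2, hQ1, hQ2] at hlt
    have e : (1 - t) / t * SS x + SS y - ((1 - t) / t * SS (M11 *ᵥ x + M12 *ᵥ y)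
        + SS (M21 *ᵥ x + M22 *ᵥ y)) = ((1 - t) * (SS x - SS (M11 *ᵥ x + M12 *ᵥ y))
        + t * (SS y - SS (M21 *ᵥ x + M22 *ᵥ y))) / t := by
      field_simp
      ring
    have := div_pos hlt ht0
    rw [← e] at this
    linarith

lemma B_iff_C :
    (∀ (Δ : Matrix w v ℂ) (ΔP : Matrix d e ℂ),
        (1 - Matrix.fromBlocks M11 M12 M21 M22 * Matrix.fromBlocks Δ 0 0 ΔP).det = 0 →
        1 < max (sigmaMax Δ) (sigmaMax ΔP)) ↔
      (∀ Δ : Matrix w v ℂ, sigmaMax Δ ≤ 1 →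
        IsUnit ((1 : Matrix v v ℂ) - M11 * Δ) ∧
        sigmaMax (M22 + M21 * Δ * ((1 : Matrix v v ℂ) - M11 * Δ)⁻¹ * M12) < 1) := by
  have hb : ∀ (Δ : Matrix w v ℂ) (ΔP : Matrix d e ℂ),
      1 - Matrix.fromBlocks M11 M12 M21 M22 * Matrix.fromBlocks Δ 0 0 ΔP =
      Matrix.fromBlocks (1 - M11 * Δ) (-(M12 * ΔP)) (-(M21 * Δ)) (1 - M22 * ΔP) := by
    intro Δ ΔP
    rw [Matrix.fromBlocks_multiply, ← Matrix.fromBlocks_one, sub_eq_add_neg,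
      Matrix.fromBlocks_neg, Matrix.fromBlocks_add]
    simp [sub_eq_add_neg]
  have hdet : ∀ (Δ : Matrix w v ℂ) (ΔP : Matrix d e ℂ), IsUnit (1 - M11 * Δ) →
      (1 - Matrix.fromBlocks M11 M12 M21 M22 * Matrix.fromBlocks Δ 0 0 ΔP).det =
      (1 - M11 * Δ).det *
        (1 - (M22 + M21 * Δ * ((1 : Matrix v v ℂ) - M11 * Δ)⁻¹ * M12) * ΔP).det := by
    intro Δ ΔP hu
    haveI := hu.invertible
    rw [hb, Matrix.det_fromBlocks₁₁, Matrix.invOf_eq_nonsing_inv]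
    congr 2
    simp only [Matrix.neg_mul, Matrix.mul_neg, neg_neg, Matrix.add_mul, Matrix.mul_assoc]
    abel
  constructor
  · intro h Δ hΔ
    have hu : IsUnit (1 - M11 * Δ) := by
      rw [Matrix.isUnit_iff_isUnit_det, isUnit_iff_ne_zero]
      intro h0
      have := h Δ 0 (by rw [hb]; simp [h0])
      refine absurd this (not_lt.2 (max_le hΔ (s2 _ fun x => ?_)))
      simpa [SS_zero] using SS_nonneg x
    refine ⟨hu, (sig_small_iff _).2 fun Y hY h0 => ?_⟩
    exact absurd (h Δ Y (by rw [hdet _ _ hu, h0, mul_zero])) (not_lt.2 (max_le hΔ hY))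
  · intro h Δ ΔP h0
    by_contra! hc
    obtain ⟨h1, h2⟩ := max_le_iff.1 hc
    obtain ⟨hu, hs⟩ := h Δ h1
    rw [hdet _ _ hu] at h0
    rcases mul_eq_zero.1 h0 with h0 | h0
    · rw [Matrix.isUnit_iff_isUnit_det, isUnit_iff_ne_zero] at hu
      exact hu h0
    · exact (sig_small_iff _).1 hs _ h2 h0

end core

/-- Structured singular value with two full complex blocks
(Lemma A.3 of the paper): equivalence of the D-scale test, the
determinant (μ) test, and robust performance. -/
theorem two_block_mu
    (nv ne nw nd : ℕ)
    (M11 : Matrix (Fin nv) (Fin nw) ℂ) (M12 : Matrix (Fin nv) (Fin nd) ℂ)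
    (M21 : Matrix (Fin ne) (Fin nw) ℂ) (M22 : Matrix (Fin ne) (Fin nd) ℂ) :
    ((∃ D : ℝ, 0 < D ∧
        sigmaMax
          (Matrix.fromBlocks ((D : ℂ) • (1 : Matrix (Fin nv) (Fin nv) ℂ)) 0 0
              (1 : Matrix (Fin ne) (Fin ne) ℂ) *
            Matrix.fromBlocks M11 M12 M21 M22 *
            Matrix.fromBlocks (((D⁻¹ : ℝ) : ℂ) • (1 : Matrix (Fin nw) (Fin nw) ℂ)) 0 0
              (1 : Matrix (Fin nd) (Fin nd) ℂ)) < 1) ↔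
      (∀ (Δ : Matrix (Fin nw) (Fin nv) ℂ) (ΔP : Matrix (Fin nd) (Fin ne) ℂ),
        (1 - Matrix.fromBlocks M11 M12 M21 M22 * Matrix.fromBlocks Δ 0 0 ΔP).det = 0 →
        1 < max (sigmaMax Δ) (sigmaMax ΔP))) ∧
    ((∀ (Δ : Matrix (Fin nw) (Fin nv) ℂ) (ΔP : Matrix (Fin nd) (Fin ne) ℂ),
        (1 - Matrix.fromBlocks M11 M12 M21 M22 * Matrix.fromBlocks Δ 0 0 ΔP).det = 0 →
        1 < max (sigmaMax Δ) (sigmaMax ΔP)) ↔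
      (∀ Δ : Matrix (Fin nw) (Fin nv) ℂ, sigmaMax Δ ≤ 1 →
        IsUnit ((1 : Matrix (Fin nv) (Fin nv) ℂ) - M11 * Δ) ∧
        sigmaMax (M22 + M21 * Δ * ((1 : Matrix (Fin nv) (Fin nv) ℂ) - M11 * Δ)⁻¹ * M12) < 1)) := by
  exact ⟨(A_iff_VB M11 M12 M21 M22).trans (B_iff_VB M11 M12 M21 M22).symm, B_iff_C M11 M12 M21 M22⟩
end
end

section
/- (Small gain theorem, state-space form.) Let A ∈ ℝ^{n×n} be Schur stable, B_w ∈ ℝ^{n×n_w}, C_v ∈ ℝ^{n_v×n}, D_vw ∈ ℝ^{n_v×n_w}, and define M₁₁(z) := C_v(zI − A)⁻¹B_w + D_vw. The following are equivalent: (A) σ̄(M₁₁(e^{iθ})) < 1 for all θ ∈ [0,2π]; (B) for every m ∈ ℕ and all matrices A_Δ ∈ ℝ^{m×m}, B_Δ ∈ ℝ^{m×n_v}, C_Δ ∈ ℝ^{n_w×m}, D_Δ ∈ ℝ^{n_w×n_v} with A_Δ Schur stable and σ̄(C_Δ(e^{iθ}I − A_Δ)⁻¹B_Δ + D_Δ)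 ≤ 1 for all θ ∈ [0,2π], the matrix I_{n_v} − D_vwD_Δ is invertible and the matrix Ã := [[A,0],[0,A_Δ]] + [[0,B_w],[B_Δ,0]] · [[I_{n_v}, −D_vw],[−D_Δ, I_{n_w}]]⁻¹ · [[C_v, 0],[0, C_Δ]] is Schur stable. -/
open Matrix

noncomputable section

/-- A real square matrix is Schur stable if every complex eigenvalue has modulus `< 1`. -/
def SchurStable {k : Type*} [Fintype k] [DecidableEq k] (A : Matrix k k ℝ) : Prop :=
  ∀ μ ∈ spectrum ℂ (A.map (algebraMap ℝ ℂ)), ‖μ‖ < 1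

/-- Transfer function of a real state-space realization, evaluated at `z ∈ ℂ`. -/
def transferFn {n k l : ℕ} (A : Matrix (Fin n) (Fin n) ℝ) (B : Matrix (Fin n) (Fin l) ℝ)
    (C : Matrix (Fin k) (Fin n) ℝ) (D : Matrix (Fin k) (Fin l) ℝ) (z : ℂ) :
    Matrix (Fin k) (Fin l) ℂ :=
  C.map (algebraMap ℝ ℂ) *
    (z • (1 : Matrix (Fin n) (Fin n) ℂ) - A.map (algebraMap ℝ ℂ))⁻¹ *
    B.map (algebraMap ℝ ℂ) + D.map (algebraMap ℝ ℂ)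

/-- State matrix of the feedback interconnection of `M₁₁` with `Δ`. -/
def interconnectA {n m nv nw : ℕ}
    (A : Matrix (Fin n) (Fin n) ℝ) (Bw : Matrix (Fin n) (Fin nw) ℝ)
    (Cv : Matrix (Fin nv) (Fin n) ℝ) (Dvw : Matrix (Fin nv) (Fin nw) ℝ)
    (AΔ : Matrix (Fin m) (Fin m) ℝ) (BΔ : Matrix (Fin m) (Fin nv) ℝ)
    (CΔ : Matrix (Fin nw) (Fin m) ℝ) (DΔ : Matrix (Fin nw) (Fin nv) ℝ) :
    Matrix ((Fin n) ⊕ (Fin m)) ((Fin n) ⊕ (Fin m)) ℝ :=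
  Matrix.fromBlocks A 0 0 AΔ +
    Matrix.fromBlocks 0 Bw BΔ 0 *
      (Matrix.fromBlocks (1 : Matrix (Fin nv) (Fin nv) ℝ) (-Dvw) (-DΔ)
        (1 : Matrix (Fin nw) (Fin nw) ℝ))⁻¹ *
      Matrix.fromBlocks Cv 0 0 CΔ

abbrev toC {k l : Type*} (M : Matrix k l ℝ) : Matrix k l ℂ := M.map (algebraMap ℝ ℂ)

lemma schur_isUnit {k : Type*} [Fintype k] [DecidableEq k] {A : Matrix k k ℝ}
    (h : SchurStable A) {z : ℂ} (hz : 1 ≤ ‖z‖) :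
    IsUnit (z • (1 : Matrix k k ℂ) - toC A) := by
  by_contra hc
  have : z ∈ spectrum ℂ (A.map (algebraMap ℝ ℂ)) := by
    rw [spectrum.mem_iff, Algebra.algebraMap_eq_smul_one]; exact hc
  exact absurd (h z this) (not_lt.mpr hz)

lemma schur_iff {k : Type*} [Fintype k] [DecidableEq k] {A : Matrix k k ℝ} :
    SchurStable A ↔ ∀ z : ℂ, 1 ≤ ‖z‖ → ∀ x : k → ℂ, toC A *ᵥ x = z • x → x = 0 := by
  constructor
  · intro h z hz x hx
    have hu := Matrix.mulVec_injective_iff_isUnit.mpr (schur_isUnit h hz)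
    apply hu
    simp [Matrix.sub_mulVec, Matrix.smul_mulVec, hx]
  · intro h z hz
    by_contra hc
    rw [spectrum.mem_iff, Algebra.algebraMap_eq_smul_one] at hz
    apply hz
    rw [← Matrix.mulVec_injective_iff_isUnit]
    intro x y hxy
    have := h z (not_lt.mp hc) (x - y) (by
      simp only [Matrix.sub_mulVec, Matrix.smul_mulVec, Matrix.one_mulVec] at hxy
      rw [Matrix.mulVec_sub, smul_sub]
      have h2 := sub_eq_zero.mpr hxy
      rw [← sub_eq_zero, ← neg_eq_zero, ← h2]
      abel)
    exact sub_eq_zero.mp this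

lemma tf_ex {n l : ℕ} {A : Matrix (Fin n) (Fin n) ℝ} (h : SchurStable A)
    (B : Matrix (Fin n) (Fin l) ℝ) {z : ℂ} (hz : 1 ≤ ‖z‖) (u : Fin l → ℂ) :
    ∃ x, toC A *ᵥ x + toC B *ᵥ u = z • x := by
  have hu := (schur_isUnit h hz)
  rw [Matrix.isUnit_iff_isUnit_det] at hu
  refine ⟨(z • (1 : Matrix (Fin n) (Fin n) ℂ) - toC A)⁻¹ *ᵥ (toC B *ᵥ u), ?_⟩
  set x := (z • (1 : Matrix (Fin n) (Fin n) ℂ) - toC A)⁻¹ *ᵥ (toC B *ᵥ u) with hx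
  have : (z • (1 : Matrix (Fin n) (Fin n) ℂ) - toC A) *ᵥ x = toC B *ᵥ u := by
    rw [hx, Matrix.mulVec_mulVec, Matrix.mul_nonsing_inv _ hu, Matrix.one_mulVec]
  rw [← this, Matrix.sub_mulVec, Matrix.smul_mulVec, Matrix.one_mulVec]
  abel

lemma tf_eq {n k l : ℕ} {A : Matrix (Fin n) (Fin n) ℝ} (h : SchurStable A)
    (B : Matrix (Fin n) (Fin l) ℝ) (C : Matrix (Fin k) (Fin n) ℝ) (D : Matrix (Fin k) (Fin l) ℝ)
    {z : ℂ} (hz : 1 ≤ ‖z‖) (u : Fin l → ℂ) (x : Fin n → ℂ)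
    (hx : toC A *ᵥ x + toC B *ᵥ u = z • x) :
    transferFn A B C D z *ᵥ u = toC C *ᵥ x + toC D *ᵥ u := by
  have hu := (schur_isUnit h hz)
  rw [Matrix.isUnit_iff_isUnit_det] at hu
  have : (z • (1 : Matrix (Fin n) (Fin n) ℂ) - toC A) *ᵥ x = toC B *ᵥ u := by
    rw [Matrix.sub_mulVec, Matrix.smul_mulVec, Matrix.one_mulVec, ← hx]; abel
  rw [transferFn, Matrix.add_mulVec, ← Matrix.mulVec_mulVec, ← Matrix.mulVec_mulVec]
  rw [← this, Matrix.mulVec_mulVec x, Matrix.nonsing_inv_mul _ hu, Matrix.one_mulVec]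

def nrm {k : Type*} [Fintype k] (x : k → ℂ) : ℝ := ‖(WithLp.toLp 2 x : EuclideanSpace ℂ k)‖

lemma sig_apply {k l : Type*} [Fintype k] [Fintype l] [DecidableEq k] [DecidableEq l]
    (M : Matrix k l ℂ) (x : l → ℂ) : nrm (M *ᵥ x) ≤ sigmaMax M * nrm x := by
  have := (LinearMap.toContinuousLinearMap (Matrix.toEuclideanLin M)).le_opNorm (WithLp.toLp 2 x)
  simpa [nrm, sigmaMax, Matrix.toLpLin_toLp] using this

lemma sig_le {k l : Type*} [Fintype k] [Fintype l] [DecidableEq k] [DecidableEq l]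
    (M : Matrix k l ℂ) (c : ℝ) (hc : 0 ≤ c) (h : ∀ x, nrm (M *ᵥ x) ≤ c * nrm x) :
    sigmaMax M ≤ c := by
  apply ContinuousLinearMap.opNorm_le_bound _ hc
  intro x
  have := h x.ofLp
  simpa [nrm, Matrix.toLpLin_apply] using this

lemma sig_ex {k l : Type*} [Fintype k] [Fintype l] [DecidableEq k] [DecidableEq l]
    (M : Matrix k l ℂ) (h : 1 ≤ sigmaMax M) : ∃ x, x ≠ 0 ∧ nrm x ≤ nrm (M *ᵥ x) := by
  by_contra hc
  push Not at hc
  set T := LinearMap.toContinuousLinearMap (Matrix.toEuclideanLin M) with hT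
  have hT' : ∀ y : EuclideanSpace ℂ l, y ≠ 0 → ‖T y‖ < ‖y‖ := by
    intro y hy
    have := hc y.ofLp (by simpa using hy)
    simpa [nrm, hT, Matrix.toLpLin_apply] using this
  rcases (Metric.sphere (0 : EuclideanSpace ℂ l) 1).eq_empty_or_nonempty with he | hne
  · have : sigmaMax M ≤ 0 := by
      apply ContinuousLinearMap.opNorm_le_bound _ le_rfl
      intro x
      have hx : x = 0 := by
        by_contra hx
        have hm : ((‖x‖⁻¹ : ℂ) • x) ∈ Metric.sphere (0 : EuclideanSpace ℂ l) 1 := by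
          simp [norm_smul, hx]
        rw [he] at hm; exact hm
      simp [hx]
    linarith
  · obtain ⟨x, hx, hmax⟩ := (isCompact_sphere (0 : EuclideanSpace ℂ l) 1).exists_isMaxOn hne
      (f := fun x => ‖T x‖) (by fun_prop)
    have hx1 : ‖x‖ = 1 := by simpa using hx
    have hx0 : x ≠ 0 := by rintro rfl; simp at hx1
    have : sigmaMax M ≤ ‖T x‖ := by
      apply ContinuousLinearMap.opNorm_le_bound _ (norm_nonneg _)
      intro y
      by_cases hy : y = 0
      · simp [hy]
      have hm : ((‖y‖⁻¹ : ℂ) • y) ∈ Metric.sphere (0 : EuclideanSpace ℂ l) 1 := by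
        simp [norm_smul, hy]
      have := hmax hm
      simp only [Set.mem_ofPred_eq, map_smul, norm_smul, norm_inv, Complex.norm_real, norm_norm] at this
      rwa [inv_mul_le_iff₀ (norm_pos_iff.mpr hy), mul_comm] at this
    have h2 := hT' x hx0
    linarith

lemma nrm_sq {k : Type*} [Fintype k] (x : k → ℂ) : nrm x ^ 2 = ∑ i, ‖x i‖ ^ 2 := by
  simp [nrm, EuclideanSpace.norm_sq_eq]

lemma nrm_nonneg {k : Type*} [Fintype k] (x : k → ℂ) : 0 ≤ nrm x := norm_nonneg _

lemma nrm_eq_zero {k : Type*} [Fintype k] (x : k → ℂ) : nrm x = 0 ↔ x = 0 := by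
  simp [nrm]

lemma angle {z : ℂ} (hz : ‖z‖ = 1) :
    ∃ θ ∈ Set.Icc (0 : ℝ) (2 * Real.pi), Complex.exp ((θ : ℂ) * Complex.I) = z := by
  have h1 : Complex.exp ((Complex.arg z : ℂ) * Complex.I) = z := by
    have := Complex.norm_mul_exp_arg_mul_I z
    simpa [hz] using this
  have := Complex.neg_pi_lt_arg z
  have := Complex.arg_le_pi z
  have := Real.pi_pos
  by_cases h : 0 ≤ Complex.arg z
  · exact ⟨Complex.arg z, ⟨h, by linarith⟩, h1⟩
  · refine ⟨Complex.arg z + 2 * Real.pi, ⟨by linarith, by linarith⟩, ?_⟩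
    push_cast
    rw [add_mul, Complex.exp_add, h1, Complex.exp_two_pi_mul_I, mul_one]

set_option maxHeartbeats 1000000 in
lemma maxmod {n k l : ℕ} {A : Matrix (Fin n) (Fin n) ℝ} (h : SchurStable A)
    (B : Matrix (Fin n) (Fin l) ℝ) (C : Matrix (Fin k) (Fin n) ℝ) (D : Matrix (Fin k) (Fin l) ℝ) :
    ∃ θ ∈ Set.Icc (0 : ℝ) (2 * Real.pi),
      (∀ z : ℂ, 1 ≤ ‖z‖ → sigmaMax (transferFn A B C D z) ≤
        sigmaMax (transferFn A B C D (Complex.exp ((θ : ℂ) * Complex.I)))) ∧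
      sigmaMax (toC D) ≤ sigmaMax (transferFn A B C D (Complex.exp ((θ : ℂ) * Complex.I))) := by
  let G : ℂ → Matrix (Fin k) (Fin l) ℂ := fun s =>
    s • (toC C * (1 - s • toC A)⁻¹ * toC B) + toC D
  have hfac : ∀ s : ℂ, s ≠ 0 → 
      (1 - s • toC A) = s • (s⁻¹ • (1 : Matrix (Fin n) (Fin n) ℂ) - toC A) := by
    intro s hs; rw [smul_sub, smul_smul, mul_inv_cancel₀ hs, one_smul]
  have hunit : ∀ s : ℂ, ‖s‖ ≤ 1 → IsUnit (1 - s • toC A).det := by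
    intro s hs
    by_cases h0 : s = 0
    · simp [h0]
    have h1 : 1 ≤ ‖s⁻¹‖ := by
      rw [norm_inv]; exact (one_le_inv₀ (norm_pos_iff.mpr h0)).mpr hs
    have hu := schur_isUnit h h1
    rw [Matrix.isUnit_iff_isUnit_det] at hu
    rw [hfac s h0, Matrix.det_smul]
    exact (IsUnit.pow _ (isUnit_iff_ne_zero.mpr h0)).mul hu
  have hG : ∀ s : ℂ, s ≠ 0 → ‖s‖ ≤ 1 → G s = transferFn A B C D s⁻¹ := by
    intro s h0 hs
    have h1 : 1 ≤ ‖s⁻¹‖ := by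
      rw [norm_inv]; exact (one_le_inv₀ (norm_pos_iff.mpr h0)).mpr hs
    have hu := schur_isUnit h h1
    rw [Matrix.isUnit_iff_isUnit_det] at hu
    simp only [G, transferFn]
    rw [hfac s h0]
    have : (s • (s⁻¹ • (1 : Matrix (Fin n) (Fin n) ℂ) - toC A))⁻¹ =
        s⁻¹ • (s⁻¹ • (1 : Matrix (Fin n) (Fin n) ℂ) - toC A)⁻¹ := by
      apply Matrix.inv_eq_right_inv
      rw [smul_mul_smul_comm, mul_inv_cancel₀ h0, Matrix.mul_nonsing_inv _ hu, one_smul]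
    rw [this, Matrix.mul_smul, Matrix.smul_mul, smul_smul, mul_inv_cancel₀ h0, one_smul]
  -- entries analytic
  have hent : ∀ s : ℂ, ‖s‖ ≤ 1 → ∀ i j, DifferentiableAt ℂ (fun s => G s i j) s := by
    intro s hs i j
    have hA : ∀ a b, DifferentiableAt ℂ (fun s : ℂ => (1 - s • toC A) a b) s := by
      intro a b
      simp only [Matrix.sub_apply, Matrix.smul_apply, smul_eq_mul]
      fun_prop
    have hdet : DifferentiableAt ℂ (fun s : ℂ => (1 - s • toC A).det) s := by
      simp only [Matrix.det_apply]
      apply DifferentiableAt.fun_sum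
      intro σ _
      apply DifferentiableAt.const_smul
      apply DifferentiableAt.fun_finsetProd
      intro i _
      exact hA _ _
    have hadj : ∀ a b, DifferentiableAt ℂ (fun s : ℂ => (1 - s • toC A).adjugate a b) s := by
      intro a b
      simp only [Matrix.adjugate_apply, Matrix.det_apply]
      apply DifferentiableAt.fun_sum
      intro σ _
      apply DifferentiableAt.const_smul
      apply DifferentiableAt.fun_finsetProd
      intro i _
      simp only [Matrix.updateRow_apply]
      split_ifs
      · fun_prop
      · exact hA _ _
    have hinv : ∀ a b, DifferentiableAt ℂ (fun s : ℂ => (1 - s • toC A)⁻¹ a b) s := by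
      intro a b
      simp only [Matrix.inv_def, Ring.inverse_eq_inv', Matrix.smul_apply, smul_eq_mul]
      exact (hdet.inv (hunit s hs).ne_zero).mul (hadj a b)
    simp only [G, Matrix.add_apply, Matrix.smul_apply, Matrix.mul_apply, smul_eq_mul]
    apply DifferentiableAt.add_const
    apply DifferentiableAt.fun_mul differentiableAt_id
    apply DifferentiableAt.fun_sum
    intro p _
    apply DifferentiableAt.mul_const
    apply DifferentiableAt.fun_sum
    intro q _
    exact (hinv q p).const_mul _
  let L : Matrix (Fin k) (Fin l) ℂ →ₗ[ℂ] (EuclideanSpace ℂ (Fin l) →L[ℂ] EuclideanSpace ℂ (Fin k)) :=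
    (LinearMap.toContinuousLinearMap).toLinearMap ∘ₗ (Matrix.toEuclideanLin).toLinearMap
  have hL : ∀ M, sigmaMax M = ‖L M‖ := fun M => rfl
  have hdiff : ∀ s : ℂ, ‖s‖ ≤ 1 → DifferentiableAt ℂ (fun s => L (G s)) s := by
    intro s hs
    have : (fun s => L (G s)) = fun s => ∑ i, ∑ j, G s i j • L (Matrix.single i j 1) := by
      funext s
      conv_lhs => rw [Matrix.matrix_eq_sum_single (G s)]
      simp only [map_sum, ← map_smul, Matrix.smul_single, smul_eq_mul, mul_one]
    rw [this]
    apply DifferentiableAt.fun_sum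
    intro i _
    apply DifferentiableAt.fun_sum
    intro j _
    exact (hent s hs i j).smul_const _
  have hd : DiffContOnCl ℂ (fun s => L (G s)) (Metric.ball 0 1) := by
    apply DifferentiableOn.diffContOnCl
    rw [closure_ball _ one_ne_zero]
    intro s hs
    exact (hdiff s (by simpa using hs)).differentiableWithinAt
  obtain ⟨s0, hs0, hmax⟩ := Complex.exists_mem_frontier_isMaxOn_norm Metric.isBounded_ball
    ⟨0, by simp⟩ hd
  rw [frontier_ball _ one_ne_zero] at hs0
  rw [closure_ball _ one_ne_zero] at hmax
  have hs1 : ‖s0‖ = 1 := by simpa using hs0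
  have hs2 : s0 ≠ 0 := by rintro rfl; simp at hs1
  obtain ⟨θ, hθ, he⟩ := angle (z := s0⁻¹) (by simp [hs1])
  refine ⟨θ, hθ, ?_, ?_⟩
  · intro z hz
    have hz0 : z ≠ 0 := by rintro rfl; norm_num at hz
    have hz1 : ‖z⁻¹‖ ≤ 1 := by rw [norm_inv]; exact inv_le_one_of_one_le₀ hz
    have := hmax (show z⁻¹ ∈ Metric.closedBall (0:ℂ) 1 by simpa using hz1)
    simp only [Set.mem_ofPred_eq, Function.comp] at this
    rw [hG _ (inv_ne_zero hz0) hz1, hG _ hs2 hs1.le, inv_inv] at this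
    rw [he]; exact this
  · have := hmax (show (0:ℂ) ∈ Metric.closedBall (0:ℂ) 1 by simp)
    simp only [Set.mem_ofPred_eq, Function.comp] at this
    rw [hG _ hs2 hs1.le] at this
    rw [he, hL, hL]
    simpa [G] using this

def Nm {nv nw : ℕ} (Dvw : Matrix (Fin nv) (Fin nw) ℝ) (DΔ : Matrix (Fin nw) (Fin nv) ℝ) :=
  Matrix.fromBlocks (1 : Matrix (Fin nv) (Fin nv) ℝ) (-Dvw) (-DΔ) (1 : Matrix (Fin nw) (Fin nw) ℝ)

lemma Nm_unit {nv nw : ℕ} {Dvw : Matrix (Fin nv) (Fin nw) ℝ} {DΔ : Matrix (Fin nw) (Fin nv) ℝ}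
    (h : IsUnit ((1 : Matrix (Fin nv) (Fin nv) ℝ) - Dvw * DΔ)) : IsUnit (Nm Dvw DΔ).det := by
  rw [Nm, Matrix.det_fromBlocks_one₂₂]
  rw [Matrix.isUnit_iff_isUnit_det] at h
  simpa using h

lemma toC_mul {k l p : Type*} [Fintype l] (M : Matrix k l ℝ) (N : Matrix l p ℝ) :
    toC (M * N) = toC M * toC N := by
  exact Matrix.map_mul

lemma toC_blocks {a b c d : Type*} (P : Matrix a c ℝ) (Q : Matrix a d ℝ) (R : Matrix b c ℝ)
    (S : Matrix b d ℝ) :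
    toC (Matrix.fromBlocks P Q R S) = Matrix.fromBlocks (toC P) (toC Q) (toC R) (toC S) := by
  simp [toC, Matrix.fromBlocks_map]

lemma toC_one {a : Type*} [DecidableEq a] : toC (1 : Matrix a a ℝ) = 1 := by
  simp [toC]
lemma toC_zero {a b : Type*} : toC (0 : Matrix a b ℝ) = 0 := by
  simp [toC]
lemma toC_neg {a b : Type*} (M : Matrix a b ℝ) : toC (-M) = - toC M := by
  ext; simp [toC]
lemma toC_add {a b : Type*} (M N : Matrix a b ℝ) : toC (M + N) = toC M + toC N := by
  ext; simp [toC]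

lemma ic_ex {n m nv nw : ℕ} {Dvw : Matrix (Fin nv) (Fin nw) ℝ} {DΔ : Matrix (Fin nw) (Fin nv) ℝ}
    (h : IsUnit ((1 : Matrix (Fin nv) (Fin nv) ℝ) - Dvw * DΔ))
    (Cv : Matrix (Fin nv) (Fin n) ℝ) (CΔ : Matrix (Fin nw) (Fin m) ℝ)
    (x : Fin n → ℂ) (y : Fin m → ℂ) :
    ∃ v w, v = toC Cv *ᵥ x + toC Dvw *ᵥ w ∧ w = toC CΔ *ᵥ y + toC DΔ *ᵥ v := by
  have hu := Nm_unit h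
  have h1 : toC (Nm Dvw DΔ) * toC (Nm Dvw DΔ)⁻¹ = 1 := by
    rw [← toC_mul, Matrix.mul_nonsing_inv _ hu, toC_one]
  set q := toC (Nm Dvw DΔ)⁻¹ *ᵥ (Sum.elim (toC Cv *ᵥ x) (toC CΔ *ᵥ y)) with hq
  have h2 : toC (Nm Dvw DΔ) *ᵥ q = Sum.elim (toC Cv *ᵥ x) (toC CΔ *ᵥ y) := by
    rw [hq, Matrix.mulVec_mulVec, h1, Matrix.one_mulVec]
  rw [Nm, toC_blocks, Matrix.fromBlocks_mulVec, toC_one, toC_one, toC_neg, toC_neg] at h2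
  have ha := congrArg (fun f => f ∘ Sum.inl) h2
  have hb := congrArg (fun f => f ∘ Sum.inr) h2
  simp only [Sum.elim_comp_inl, Sum.elim_comp_inr, Matrix.one_mulVec, Matrix.neg_mulVec] at ha hb
  refine ⟨q ∘ Sum.inl, q ∘ Sum.inr, ?_, ?_⟩
  · rw [← ha]; abel
  · rw [← hb]; abel

lemma ic_eq {n m nv nw : ℕ}
    (A : Matrix (Fin n) (Fin n) ℝ) (Bw : Matrix (Fin n) (Fin nw) ℝ)
    (Cv : Matrix (Fin nv) (Fin n) ℝ) {Dvw : Matrix (Fin nv) (Fin nw) ℝ}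
    (AΔ : Matrix (Fin m) (Fin m) ℝ) (BΔ : Matrix (Fin m) (Fin nv) ℝ)
    (CΔ : Matrix (Fin nw) (Fin m) ℝ) {DΔ : Matrix (Fin nw) (Fin nv) ℝ}
    (h : IsUnit ((1 : Matrix (Fin nv) (Fin nv) ℝ) - Dvw * DΔ))
    (x : Fin n → ℂ) (y : Fin m → ℂ) (v : Fin nv → ℂ) (w : Fin nw → ℂ)
    (hv : v = toC Cv *ᵥ x + toC Dvw *ᵥ w) (hw : w = toC CΔ *ᵥ y + toC DΔ *ᵥ v) :
    toC (interconnectA A Bw Cv Dvw AΔ BΔ CΔ DΔ) *ᵥ (Sum.elim x y) =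
      Sum.elim (toC A *ᵥ x + toC Bw *ᵥ w) (toC AΔ *ᵥ y + toC BΔ *ᵥ v) := by
  have hu := Nm_unit h
  have h1 : toC (Nm Dvw DΔ)⁻¹ * toC (Nm Dvw DΔ) = 1 := by
    rw [← toC_mul, Matrix.nonsing_inv_mul _ hu, toC_one]
  have h2 : toC (Nm Dvw DΔ) *ᵥ (Sum.elim v w) = Sum.elim (toC Cv *ᵥ x) (toC CΔ *ᵥ y) := by
    rw [Nm, toC_blocks, Matrix.fromBlocks_mulVec, toC_one, toC_one, toC_neg, toC_neg]
    simp only [Sum.elim_comp_inl, Sum.elim_comp_inr, Matrix.one_mulVec, Matrix.neg_mulVec]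
    congr 1
    · nth_rewrite 1 [hv]; abel
    · have : toC CΔ *ᵥ y = w - toC DΔ *ᵥ v := by rw [eq_sub_iff_add_eq]; exact hw.symm
      rw [this]; abel
  have h3 : toC (Nm Dvw DΔ)⁻¹ *ᵥ (Sum.elim (toC Cv *ᵥ x) (toC CΔ *ᵥ y)) = Sum.elim v w := by
    rw [← h2, Matrix.mulVec_mulVec, h1, Matrix.one_mulVec]
  have h4 : toC (Matrix.fromBlocks Cv 0 0 CΔ) *ᵥ (Sum.elim x y) =
      Sum.elim (toC Cv *ᵥ x) (toC CΔ *ᵥ y) := by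
    rw [toC_blocks, Matrix.fromBlocks_mulVec]; simp
  rw [interconnectA, toC_add, toC_mul, toC_mul, Matrix.add_mulVec, ← Matrix.mulVec_mulVec, h4,
    ← Matrix.mulVec_mulVec]
  change _ + _ *ᵥ (toC (Nm Dvw DΔ)⁻¹ *ᵥ _) = _
  rw [h3, toC_blocks, toC_blocks, Matrix.fromBlocks_mulVec, Matrix.fromBlocks_mulVec]
  ext (i | i) <;> simp

lemma forward {n nv nw : ℕ}
    {A : Matrix (Fin n) (Fin n) ℝ} (hA : SchurStable A)
    (Bw : Matrix (Fin n) (Fin nw) ℝ)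
    (Cv : Matrix (Fin nv) (Fin n) ℝ) (Dvw : Matrix (Fin nv) (Fin nw) ℝ)
    (hM : ∀ θ ∈ Set.Icc (0 : ℝ) (2 * Real.pi),
        sigmaMax (transferFn A Bw Cv Dvw (Complex.exp ((θ : ℂ) * Complex.I))) < 1)
    (m : ℕ) (AΔ : Matrix (Fin m) (Fin m) ℝ) (BΔ : Matrix (Fin m) (Fin nv) ℝ)
        (CΔ : Matrix (Fin nw) (Fin m) ℝ) (DΔ : Matrix (Fin nw) (Fin nv) ℝ)
        (hΔ : SchurStable AΔ)
        (hD : ∀ θ ∈ Set.Icc (0 : ℝ) (2 * Real.pi),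
          sigmaMax (transferFn AΔ BΔ CΔ DΔ (Complex.exp ((θ : ℂ) * Complex.I))) ≤ 1) :
        IsUnit ((1 : Matrix (Fin nv) (Fin nv) ℝ) - Dvw * DΔ) ∧
        SchurStable (interconnectA A Bw Cv Dvw AΔ BΔ CΔ DΔ) := by
  obtain ⟨θ1, hθ1, hM1, hM2⟩ := maxmod hA Bw Cv Dvw
  obtain ⟨θ2, hθ2, hD1, hD2⟩ := maxmod hΔ BΔ CΔ DΔ
  have key : ∀ (P : Matrix (Fin nv) (Fin nw) ℂ) (Q : Matrix (Fin nw) (Fin nv) ℂ) v w,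
      sigmaMax P < 1 → sigmaMax Q ≤ 1 → v = P *ᵥ w → w = Q *ᵥ v → v = 0 ∧ w = 0 := by
    intro P Q v w hP hQ hv hw
    have h1 := sig_apply P w
    have h2 := sig_apply Q v
    rw [← hv] at h1
    rw [← hw] at h2
    have h3 : nrm w = 0 := by
      have := nrm_nonneg w
      have := nrm_nonneg v
      nlinarith
    have h4 : w = 0 := (nrm_eq_zero w).mp h3
    exact ⟨by rw [hv, h4, Matrix.mulVec_zero], h4⟩
  have hu : IsUnit ((1 : Matrix (Fin nv) (Fin nv) ℝ) - Dvw * DΔ) := by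
    have : IsUnit (toC ((1 : Matrix (Fin nv) (Fin nv) ℝ) - Dvw * DΔ)) := by
      rw [← Matrix.mulVec_injective_iff_isUnit]
      have hz : ∀ v, toC ((1 : Matrix (Fin nv) (Fin nv) ℝ) - Dvw * DΔ) *ᵥ v = 0 → v = 0 := by
        intro v hv
        rw [sub_eq_add_neg, toC_add, toC_neg, toC_mul, toC_one, Matrix.add_mulVec,
          Matrix.one_mulVec, Matrix.neg_mulVec, ← Matrix.mulVec_mulVec, ← sub_eq_add_neg,
          sub_eq_zero] at hv
        exact (key _ _ v _ (lt_of_le_of_lt hM2 (hM θ1 hθ1)) (hD2.trans (hD θ2 hθ2)) hv rfl).1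
      intro a b hab
      refine sub_eq_zero.mp (hz _ ?_)
      rw [Matrix.mulVec_sub]; exact sub_eq_zero.mpr hab
    rw [Matrix.isUnit_iff_isUnit_det] at this ⊢
    have hdet : (toC ((1 : Matrix (Fin nv) (Fin nv) ℝ) - Dvw * DΔ)).det =
      algebraMap ℝ ℂ ((1 : Matrix (Fin nv) (Fin nv) ℝ) - Dvw * DΔ).det := by
      rw [RingHom.map_det]; rfl
    rw [hdet] at this
    rw [isUnit_iff_ne_zero] at this ⊢
    intro h0
    simp [h0] at this
  refine ⟨hu, schur_iff.mpr ?_⟩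
  intro z hz p hp
  set x := p ∘ Sum.inl with hx
  set y := p ∘ Sum.inr with hy
  have hpe : p = Sum.elim x y := by ext (i | i) <;> rfl
  obtain ⟨v, w, hv, hw⟩ := ic_ex hu Cv CΔ x y
  rw [hpe, ic_eq A Bw Cv AΔ BΔ CΔ hu x y v w hv hw] at hp
  have ha : toC A *ᵥ x + toC Bw *ᵥ w = z • x := by
    funext i; simpa using congrFun hp (Sum.inl i)
  have hb : toC AΔ *ᵥ y + toC BΔ *ᵥ v = z • y := by
    funext i; simpa using congrFun hp (Sum.inr i)
  have hv' := tf_eq hA Bw Cv Dvw hz w x ha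
  have hw' := tf_eq hΔ BΔ CΔ DΔ hz v y hb
  obtain ⟨v0, w0⟩ := key _ _ v w (lt_of_le_of_lt (hM1 z hz) (hM θ1 hθ1))
    ((hD1 z hz).trans (hD θ2 hθ2)) (hv.trans hv'.symm) (hw.trans hw'.symm)
  rw [w0, Matrix.mulVec_zero, add_zero] at ha
  rw [v0, Matrix.mulVec_zero, add_zero] at hb
  have hx0 := schur_iff.mp hA z hz x ha
  have hy0 := schur_iff.mp hΔ z hz y hb
  rw [hpe, hx0, hy0]
  ext (i | i) <;> rfl

lemma den_ne {a : ℝ} (ha : |a| < 1) {z : ℂ} (hz : 1 ≤ ‖z‖) : z - (a : ℂ) ≠ 0 := by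
  intro h
  rw [sub_eq_zero] at h
  rw [h, Complex.norm_real, Real.norm_eq_abs] at hz
  linarith

lemma interp1 {z0 c : ℂ} (hz0 : ‖z0‖ = 1) (hc : ‖c‖ = 1) (h : c.im * z0.im < 0) :
    ∃ a b d : ℝ, |a| < 1 ∧ (∀ z : ℂ, ‖z‖ = 1 → ‖(b : ℂ) / (z - a) + d‖ = 1) ∧
      (b : ℂ) / (z0 - a) + d = c := by
  have hz2 : z0.re ^ 2 + z0.im ^ 2 = 1 := by
    have := Complex.sq_norm z0; rw [hz0, Complex.normSq_apply] at this; nlinarith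
  have hc2 : c.re ^ 2 + c.im ^ 2 = 1 := by
    have := Complex.sq_norm c; rw [hc, Complex.normSq_apply] at this; nlinarith
  have hne : z0 - c ≠ 0 := by
    intro h0
    rw [sub_eq_zero] at h0
    rw [h0] at h; nlinarith [sq_nonneg c.im]
  have hzc : z0 * (starRingEnd ℂ) z0 = 1 := by
    rw [Complex.mul_conj, Complex.normSq_eq_norm_sq, hz0]; simp
  have hcc : c * (starRingEnd ℂ) c = 1 := by
    rw [Complex.mul_conj, Complex.normSq_eq_norm_sq, hc]; simp
  have hne' : (starRingEnd ℂ) z0 - (starRingEnd ℂ) c ≠ 0 := by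
    rw [← map_sub]; exact (map_ne_zero _).mpr hne
  obtain ⟨a, ha⟩ : ∃ a : ℝ, (1 - c * z0) / (z0 - c) = (a : ℂ) := by
    rw [← Complex.conj_eq_iff_real.eq]
    rw [map_div₀, map_sub, map_sub, map_mul, map_one, div_eq_div_iff hne' hne]
    linear_combination (c - (starRingEnd ℂ) c) * hzc + ((starRingEnd ℂ) z0 - z0) * hcc
  have habs : |a| < 1 := by
    have h1 : ‖(1 - c * z0) / (z0 - c)‖ = |a| := by rw [ha]; simp
    rw [← h1, norm_div, div_lt_one (norm_pos_iff.mpr hne)]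
    apply lt_of_pow_lt_pow_left₀ 2 (norm_nonneg _)
    rw [Complex.sq_norm, Complex.sq_norm, Complex.normSq_apply, Complex.normSq_apply]
    simp
    nlinarith
  have hfe : ∀ z : ℂ, ‖z‖ = 1 →
      (((1 - a ^ 2 : ℝ) : ℂ) / (z - a) + ((-a : ℝ) : ℂ)) = (1 - a * z) / (z - a) := by
    intro z hz
    have := den_ne habs hz.ge
    field_simp
    push_cast
    ring
  refine ⟨a, 1 - a ^ 2, -a, habs, ?_, ?_⟩
  · intro z hz
    have hd := den_ne habs hz.ge
    rw [hfe z hz, norm_div, div_eq_one_iff_eq (norm_ne_zero_iff.mpr hd)]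
    have hz2 : z.re ^ 2 + z.im ^ 2 = 1 := by
      have := Complex.sq_norm z; rw [hz, Complex.normSq_apply] at this; nlinarith
    rw [← sq_eq_sq₀ (norm_nonneg _) (norm_nonneg _)]
    rw [Complex.sq_norm, Complex.sq_norm, Complex.normSq_apply, Complex.normSq_apply]
    simp
    linear_combination (a ^ 2 - 1) * hz2
  · have hd := den_ne habs hz0.ge
    rw [hfe z0 hz0, div_eq_iff hd]
    rw [div_eq_iff hne] at ha
    linear_combination ha

lemma interp {z0 c : ℂ} (hz0 : ‖z0‖ = 1) (h : z0.im ≠ 0 ∨ c.im = 0) :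
    ∃ a b d : ℝ, |a| < 1 ∧ (∀ z : ℂ, ‖z‖ = 1 → ‖(b : ℂ) / (z - a) + d‖ = ‖c‖) ∧
      (b : ℂ) / (z0 - a) + d = c := by
  by_cases hci : c.im = 0
  · have : (c.re : ℂ) = c := by apply Complex.ext <;> simp [hci]
    refine ⟨0, 0, c.re, by simp, ?_, ?_⟩
    · intro z _; simp [this]
    · simp [this]
  have hzi : z0.im ≠ 0 := by tauto
  have hc0 : c ≠ 0 := by rintro rfl; simp at hci
  -- unit direction
  have main : ∀ r : ℝ, |r| = ‖c‖ → (c / r).im * z0.im < 0 → ∃ a b d : ℝ, |a| < 1 ∧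
      (∀ z : ℂ, ‖z‖ = 1 → ‖(b : ℂ) / (z - a) + d‖ = ‖c‖) ∧ (b : ℂ) / (z0 - a) + d = c := by
    intro r hr hlt
    have hn : ‖c‖ ≠ 0 := norm_ne_zero_iff.mpr hc0
    have hr0 : (r : ℂ) ≠ 0 := by
      intro h0; have : r = 0 := by exact_mod_cast h0
      rw [this] at hr; simp at hr; exact hn hr.symm
    obtain ⟨a, b, d, h1, h2, h3⟩ := interp1 hz0 (c := c / r)
      (by rw [norm_div, Complex.norm_real, Real.norm_eq_abs, hr, div_self hn]) hlt
    have hs : ∀ z : ℂ, ((r * b : ℝ) : ℂ) / (z - a) + ((r * d : ℝ) : ℂ) =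
        r * ((b : ℂ) / (z - a) + d) := by
      intro z; push_cast; ring
    refine ⟨a, r * b, r * d, h1, ?_, ?_⟩
    · intro z hz
      rw [hs, norm_mul, h2 z hz, Complex.norm_real, Real.norm_eq_abs, hr, mul_one]
    · rw [hs, h3, mul_div_cancel₀ _ hr0]
  have hn : 0 < ‖c‖ := norm_pos_iff.mpr hc0
  have hprod : c.im * z0.im ≠ 0 := mul_ne_zero hci hzi
  rcases lt_or_gt_of_ne hprod with hlt | hgt
  · apply main ‖c‖ (by simp)
    rw [Complex.div_ofReal_im, div_mul_eq_mul_div]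
    exact div_neg_of_neg_of_pos hlt hn
  · apply main (-‖c‖) (by simp)
    rw [Complex.div_ofReal_im, div_mul_eq_mul_div]
    exact div_neg_of_pos_of_neg hgt (by linarith)

lemma toC_vecMulVec {k l : Type*} [Fintype l] (a : k → ℝ) (b : l → ℝ) (x : l → ℂ) (i : k) :
    (toC (Matrix.vecMulVec a b) *ᵥ x) i = (a i : ℂ) * ∑ j, (b j : ℂ) * x j := by
  simp [toC, Matrix.mulVec, dotProduct, Matrix.vecMulVec_apply, Finset.mul_sum, mul_assoc]

lemma toC_diagonal {k : Type*} [Fintype k] [DecidableEq k] (a : k → ℝ) (x : k → ℂ) (i : k) :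
    (toC (Matrix.diagonal a) *ᵥ x) i = (a i : ℂ) * x i := by
  have : toC (Matrix.diagonal a) = Matrix.diagonal (fun i => (a i : ℂ)) := by
    rw [toC, Matrix.diagonal_map (by simp)]; rfl
  rw [this, Matrix.mulVec_diagonal]

lemma realize {nv nw : ℕ} (af bf df : Fin nw → ℝ) (ag bg dg : Fin nv → ℝ)
    (haf : ∀ i, |af i| < 1) (hag : ∀ j, |ag j| < 1) :
    ∃ (m : ℕ) (AΔ : Matrix (Fin m) (Fin m) ℝ) (BΔ : Matrix (Fin m) (Fin nv) ℝ)
      (CΔ : Matrix (Fin nw) (Fin m) ℝ) (DΔ : Matrix (Fin nw) (Fin nv) ℝ), SchurStable AΔ ∧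
      ∀ z : ℂ, 1 ≤ ‖z‖ → ∀ u, transferFn AΔ BΔ CΔ DΔ z *ᵥ u =
        (∑ j, ((bg j : ℂ) / (z - ag j) + dg j) * u j) •
          (fun i => (bf i : ℂ) / (z - af i) + df i) := by
  let e : Fin nw ⊕ Fin nv ≃ Fin (nw + nv) := finSumFinEquiv
  let A0 : Matrix (Fin nw ⊕ Fin nv) (Fin nw ⊕ Fin nv) ℝ :=
    Matrix.fromBlocks (Matrix.diagonal af) (Matrix.vecMulVec bf bg) 0 (Matrix.diagonal ag)
  let B0 : Matrix (Fin nw ⊕ Fin nv) (Fin nv) ℝ := Matrix.fromRows (Matrix.vecMulVec bf dg) 1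
  let C0 : Matrix (Fin nw) (Fin nw ⊕ Fin nv) ℝ := Matrix.fromCols 1 (Matrix.vecMulVec df bg)
  have hA0 : ∀ x y, toC A0 *ᵥ Sum.elim x y = Sum.elim
      (fun i => (af i : ℂ) * x i + bf i * ∑ j, (bg j : ℂ) * y j) (fun j => (ag j : ℂ) * y j) := by
    intro x y
    rw [toC_blocks, Matrix.fromBlocks_mulVec]
    ext (i | i)
    · simp only [Sum.elim_inl, Sum.elim_comp_inl, Sum.elim_comp_inr, Pi.add_apply, toC_diagonal, toC_vecMulVec]
    · simp only [Sum.elim_inr, Sum.elim_comp_inl, Sum.elim_comp_inr, Pi.add_apply, toC_diagonal, toC_zero,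
        Matrix.zero_mulVec, Pi.zero_apply, zero_add]
  have hB0 : ∀ u, toC B0 *ᵥ u = Sum.elim (fun i => (bf i : ℂ) * ∑ j, (dg j : ℂ) * u j) u := by
    intro u
    have : toC B0 = Matrix.fromRows (toC (Matrix.vecMulVec bf dg)) (toC 1) := by
      ext (i | i) j <;> rfl
    rw [this, Matrix.fromRows_mulVec, toC_one, Matrix.one_mulVec]
    ext (i | i)
    · simp only [Sum.elim_inl, toC_vecMulVec]
    · rfl
  have hC0 : ∀ x y, toC C0 *ᵥ Sum.elim x y =
      fun i => x i + (df i : ℂ) * ∑ j, (bg j : ℂ) * y j := by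
    intro x y
    have : toC C0 = Matrix.fromCols (toC 1) (toC (Matrix.vecMulVec df bg)) := by
      ext i (j | j) <;> rfl
    rw [this, Matrix.fromCols_mulVec, toC_one, Matrix.one_mulVec]
    funext i
    simp only [Sum.elim_comp_inl, Sum.elim_comp_inr, Pi.add_apply, toC_vecMulVec]
  have hS : SchurStable (A0.submatrix e.symm e.symm) := by
    rw [schur_iff]
    intro z hz x hx
    have hx' : toC A0 *ᵥ (x ∘ e) = z • (x ∘ e) := by
      have h1 : toC (A0.submatrix e.symm e.symm) = (toC A0).submatrix e.symm e.symm := rfl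
      rw [h1, Matrix.submatrix_mulVec_equiv] at hx
      funext i
      have := congrFun hx (e i)
      simpa using this
    have hs : x ∘ e = Sum.elim (fun i => x (e (Sum.inl i))) (fun i => x (e (Sum.inr i))) := by
      ext (i | i) <;> rfl
    rw [hs, hA0] at hx'
    have hy0 : ∀ j, x (e (Sum.inr j)) = 0 := by
      intro j
      have := congrFun hx' (Sum.inr j)
      simp only [Sum.elim_inr, Pi.smul_apply, smul_eq_mul] at this
      have h2 : (z - ag j) * x (e (Sum.inr j)) = 0 := by linear_combination -this
      exact (mul_eq_zero.mp h2).resolve_left (den_ne (hag j) hz)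
    have hx0 : ∀ j, x (e (Sum.inl j)) = 0 := by
      intro j
      have := congrFun hx' (Sum.inl j)
      simp only [Sum.elim_inl, Pi.smul_apply, smul_eq_mul, hy0, mul_zero, Finset.sum_const_zero, add_zero] at this
      have h2 : (z - af j) * x (e (Sum.inl j)) = 0 := by linear_combination -this
      exact (mul_eq_zero.mp h2).resolve_left (den_ne (haf j) hz)
    funext i
    obtain ⟨i, rfl⟩ := e.surjective i
    rcases i with i | i
    · exact hx0 i
    · exact hy0 i
  refine ⟨nw + nv, A0.submatrix e.symm e.symm, B0.submatrix e.symm id, C0.submatrix id e.symm,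
    Matrix.vecMulVec df dg, hS, ?_⟩
  intro z hz u
  set s : ℂ := ∑ j, ((bg j : ℂ) / (z - ag j) + dg j) * u j with hs
  let y : Fin nv → ℂ := fun j => u j / (z - ag j)
  let x : Fin nw → ℂ := fun i => bf i * s / (z - af i)
  have hs2 : (∑ j, (bg j : ℂ) * y j) + ∑ j, (dg j : ℂ) * u j = s := by
    rw [hs, ← Finset.sum_add_distrib]
    apply Finset.sum_congr rfl
    intro j _
    simp only [y]; ring
  rw [tf_eq hS _ _ _ hz u ((Sum.elim x y) ∘ e.symm)]
  · have h1 : toC (C0.submatrix id e.symm) = (toC C0).submatrix id e.symm := rfl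
    rw [h1, Matrix.submatrix_mulVec_equiv]
    have h3 : (Sum.elim x y ∘ e.symm) ∘ e.symm.symm = Sum.elim x y := by
      ext i; simp
    rw [h3, hC0]
    funext i
    simp only [Pi.add_apply, Function.comp, id, toC_vecMulVec, Pi.smul_apply, smul_eq_mul]
    simp only [x]
    rw [← hs2]; ring
  · have h1 : toC (A0.submatrix e.symm e.symm) = (toC A0).submatrix e.symm e.symm := rfl
    have h2 : toC (B0.submatrix e.symm id) *ᵥ u = (toC B0 *ᵥ u) ∘ e.symm := rfl
    have h3 : (Sum.elim x y ∘ e.symm) ∘ e.symm.symm = Sum.elim x y := by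
      ext i; simp
    rw [h1, Matrix.submatrix_mulVec_equiv, h2, hB0, h3, hA0]
    funext i
    obtain ⟨i, rfl⟩ := e.surjective i
    rcases i with i | i
    · simp only [Pi.add_apply, Function.comp, Equiv.symm_apply_apply, Sum.elim_inl, Pi.smul_apply, smul_eq_mul]
      have hd := den_ne (haf i) hz
      have hx : (z - af i) * x i = bf i * s := by simp only [x]; field_simp
      linear_combination (bf i : ℂ) * hs2 - hx
    · simp only [Pi.add_apply, Function.comp, Equiv.symm_apply_apply, Sum.elim_inr, Pi.smul_apply, smul_eq_mul]
      have hd := den_ne (hag i) hz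
      have hx : (z - ag i) * y i = u i := by simp only [y]; field_simp
      linear_combination -hx

lemma nrm_smul {k : Type*} [Fintype k] (c : ℂ) (x : k → ℂ) : nrm (c • x) = ‖c‖ * nrm x := by
  rw [nrm, nrm, WithLp.toLp_smul, norm_smul]

lemma nrm_congr {k : Type*} [Fintype k] (x y : k → ℂ) (h : ∀ i, ‖x i‖ = ‖y i‖) : nrm x = nrm y := by
  rw [← sq_eq_sq₀ (nrm_nonneg _) (nrm_nonneg _), nrm_sq, nrm_sq]
  simp [h]

lemma cs {k : Type*} [Fintype k] (x y : k → ℂ) : ‖∑ j, x j * y j‖ ≤ nrm x * nrm y := by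
  refine (pow_le_pow_iff_left₀ (norm_nonneg _) (mul_nonneg (nrm_nonneg _) (nrm_nonneg _)) two_ne_zero).mp ?_
  rw [mul_pow, nrm_sq, nrm_sq]
  calc ‖∑ j, x j * y j‖ ^ 2 ≤ (∑ j, ‖x j‖ * ‖y j‖) ^ 2 := by
        gcongr
        refine (norm_sum_le _ _).trans (le_of_eq ?_)
        simp
    _ ≤ _ := Finset.sum_mul_sq_le_sq_mul_sq _ _ _

/-- The heart of the converse: destabilising perturbation. -/
lemma backward {n nv nw : ℕ}
    {A : Matrix (Fin n) (Fin n) ℝ} (hA : SchurStable A)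
    (Bw : Matrix (Fin n) (Fin nw) ℝ)
    (Cv : Matrix (Fin nv) (Fin n) ℝ) (Dvw : Matrix (Fin nv) (Fin nw) ℝ)
    (hB : ∀ (m : ℕ) (AΔ : Matrix (Fin m) (Fin m) ℝ) (BΔ : Matrix (Fin m) (Fin nv) ℝ)
        (CΔ : Matrix (Fin nw) (Fin m) ℝ) (DΔ : Matrix (Fin nw) (Fin nv) ℝ),
        SchurStable AΔ →
        (∀ θ ∈ Set.Icc (0 : ℝ) (2 * Real.pi),
          sigmaMax (transferFn AΔ BΔ CΔ DΔ (Complex.exp ((θ : ℂ) * Complex.I))) ≤ 1) →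
        IsUnit ((1 : Matrix (Fin nv) (Fin nv) ℝ) - Dvw * DΔ) ∧
        SchurStable (interconnectA A Bw Cv Dvw AΔ BΔ CΔ DΔ))
    (z0 : ℂ) (hz0 : ‖z0‖ = 1) (w : Fin nw → ℂ) (hw0 : w ≠ 0)
    (hle : nrm w ≤ nrm (transferFn A Bw Cv Dvw z0 *ᵥ w))
    (hreal : z0.im ≠ 0 ∨ ((∀ i, (w i).im = 0) ∧
      ∀ j, ((transferFn A Bw Cv Dvw z0 *ᵥ w) j).im = 0)) : False := by
  set v := transferFn A Bw Cv Dvw z0 *ᵥ w with hv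
  have hwp : 0 < nrm w := lt_of_le_of_ne (nrm_nonneg _) (fun h => hw0 ((nrm_eq_zero w).mp h.symm))
  have hvp : 0 < nrm v := hwp.trans_le hle
  let g : Fin nv → ℂ := fun j => (((nrm v ^ 2)⁻¹ : ℝ) : ℂ) * (starRingEnd ℂ) (v j)
  have hgv : ∑ j, g j * v j = 1 := by
    simp only [g, mul_assoc, ← Finset.mul_sum]
    have : ∑ j, (starRingEnd ℂ) (v j) * v j = ((nrm v ^ 2 : ℝ) : ℂ) := by
      rw [nrm_sq]; push_cast
      apply Finset.sum_congr rfl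
      intro j _
      rw [mul_comm, Complex.mul_conj, Complex.normSq_eq_norm_sq]; push_cast; rfl
    rw [this, ← Complex.ofReal_mul, inv_mul_cancel₀ (by positivity)]; simp
  have hgn : nrm g = (nrm v)⁻¹ := by
    have h1 : nrm g = ‖(((nrm v ^ 2)⁻¹ : ℝ) : ℂ)‖ * nrm v := by
      rw [← nrm_smul]
      apply nrm_congr
      intro j; simp [g]
    rw [h1, Complex.norm_real, Real.norm_eq_abs, abs_of_pos (by positivity)]
    field_simp
  have hf : ∀ i, ∃ a b d : ℝ, |a| < 1 ∧ (∀ z : ℂ, ‖z‖ = 1 → ‖(b : ℂ) / (z - a) + d‖ = ‖w i‖) ∧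
      (b : ℂ) / (z0 - a) + d = w i := fun i => interp hz0 (hreal.imp id (fun h => h.1 i))
  have hg : ∀ j, ∃ a b d : ℝ, |a| < 1 ∧ (∀ z : ℂ, ‖z‖ = 1 → ‖(b : ℂ) / (z - a) + d‖ = ‖g j‖) ∧
      (b : ℂ) / (z0 - a) + d = g j := fun j => interp hz0 (hreal.imp id (fun h => by
        simp only [g]
        rw [Complex.im_ofReal_mul, Complex.conj_im, h.2 j]; simp))
  choose af bf df haf hfn hfz using hf
  choose ag bg dg hag hgn' hgz using hg
  obtain ⟨m, AΔ, BΔ, CΔ, DΔ, hS, hT⟩ := realize af bf df ag bg dg haf hag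
  obtain ⟨hu, hst⟩ := hB m AΔ BΔ CΔ DΔ hS (by
    intro θ _
    have hz := Complex.norm_exp_ofReal_mul_I θ
    set z := Complex.exp ((θ : ℂ) * Complex.I)
    apply sig_le _ _ zero_le_one
    intro u
    rw [hT z hz.ge, nrm_smul, one_mul]
    have h1 : nrm (fun i => (bf i : ℂ) / (z - af i) + df i) = nrm w :=
      nrm_congr _ _ (fun i => hfn i z hz)
    have h2 : nrm (fun j => (bg j : ℂ) / (z - ag j) + dg j) = (nrm v)⁻¹ := by
      rw [← hgn]; exact nrm_congr _ _ (fun i => hgn' i z hz)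
    have h3 := cs (fun j => (bg j : ℂ) / (z - ag j) + dg j) u
    rw [h2] at h3
    rw [h1]
    calc _ ≤ ((nrm v)⁻¹ * nrm u) * nrm w := by gcongr
      _ ≤ ((nrm v)⁻¹ * nrm u) * nrm v := by
        gcongr
        exact mul_nonneg (by positivity) (nrm_nonneg _)
      _ = nrm u := by field_simp)
  have hw : w = transferFn AΔ BΔ CΔ DΔ z0 *ᵥ v := by
    rw [hT z0 hz0.ge]
    simp only [hfz, hgz, hgv, one_smul]
  obtain ⟨x, hx⟩ := tf_ex hA Bw hz0.ge w
  obtain ⟨y, hy⟩ := tf_ex hS BΔ hz0.ge v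
  have hv1 := hv.trans (tf_eq hA Bw Cv Dvw hz0.ge w x hx)
  have hw1 := hw.trans (tf_eq hS BΔ CΔ DΔ hz0.ge v y hy)
  have hic := ic_eq A Bw Cv AΔ BΔ CΔ hu x y v w hv1 hw1
  rw [hx, hy] at hic
  have h0 := schur_iff.mp hst z0 hz0.ge (Sum.elim x y) (by
    rw [hic]; ext (i | i) <;> rfl)
  have hx0 : x = 0 := by funext i; exact congrFun h0 (Sum.inl i)
  have hy0 : y = 0 := by funext i; exact congrFun h0 (Sum.inr i)
  rw [hx0, Matrix.mulVec_zero, zero_add] at hv1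
  rw [hy0, Matrix.mulVec_zero, zero_add] at hw1
  have hv2 : toC ((1 : Matrix (Fin nv) (Fin nv) ℝ) - Dvw * DΔ) *ᵥ v = 0 := by
    rw [sub_eq_add_neg, toC_add, toC_neg, toC_mul, toC_one, Matrix.add_mulVec,
      Matrix.one_mulVec, Matrix.neg_mulVec, ← Matrix.mulVec_mulVec, ← hw1, ← hv1]
    abel
  have hi : toC ((1 : Matrix (Fin nv) (Fin nv) ℝ) - Dvw * DΔ)⁻¹ *
      toC ((1 : Matrix (Fin nv) (Fin nv) ℝ) - Dvw * DΔ) = 1 := by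
    rw [← toC_mul, Matrix.nonsing_inv_mul _ ((Matrix.isUnit_iff_isUnit_det _).mp hu), toC_one]
  have hv3 : v = 0 := by
    rw [← Matrix.one_mulVec v, ← hi, ← Matrix.mulVec_mulVec, hv2, Matrix.mulVec_zero]
  rw [(nrm_eq_zero v).mpr hv3] at hvp
  exact lt_irrefl _ hvp

lemma tf_real {n k l : ℕ} (A : Matrix (Fin n) (Fin n) ℝ) (B : Matrix (Fin n) (Fin l) ℝ)
    (C : Matrix (Fin k) (Fin n) ℝ) (D : Matrix (Fin k) (Fin l) ℝ) (hA : SchurStable A)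
    (r : ℝ) (hr : 1 ≤ ‖(r : ℂ)‖) :
    ∃ M : Matrix (Fin k) (Fin l) ℝ, transferFn A B C D r = toC M := by
  refine ⟨C * (r • (1 : Matrix (Fin n) (Fin n) ℝ) - A)⁻¹ * B + D, ?_⟩
  have h1 : toC (r • (1 : Matrix (Fin n) (Fin n) ℝ) - A) = (r : ℂ) • 1 - toC A := by
    ext i j; by_cases hij : i = j <;> simp [toC, Matrix.one_apply, hij]
  have hu : IsUnit (r • (1 : Matrix (Fin n) (Fin n) ℝ) - A).det := by
    have h := (Matrix.isUnit_iff_isUnit_det _).mp (schur_isUnit hA hr)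
    rw [← h1] at h
    have hdet : (toC (r • (1 : Matrix (Fin n) (Fin n) ℝ) - A)).det =
      algebraMap ℝ ℂ (r • (1 : Matrix (Fin n) (Fin n) ℝ) - A).det := by
      rw [RingHom.map_det]; rfl
    rw [hdet] at h
    rw [isUnit_iff_ne_zero] at h ⊢
    intro h0
    simp [h0] at h
  have h2 : ((r : ℂ) • 1 - toC A)⁻¹ = toC (r • (1 : Matrix (Fin n) (Fin n) ℝ) - A)⁻¹ := by
    apply Matrix.inv_eq_right_inv
    rw [← h1, ← toC_mul, Matrix.mul_nonsing_inv _ hu, toC_one]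
  rw [transferFn, toC_add, toC_mul, toC_mul]
  rw [← h2]

lemma real_split {k l : ℕ} (M : Matrix (Fin k) (Fin l) ℝ) (w : Fin l → ℂ) (hw0 : w ≠ 0)
    (hle : nrm w ≤ nrm (toC M *ᵥ w)) :
    ∃ p : Fin l → ℂ, p ≠ 0 ∧ nrm p ≤ nrm (toC M *ᵥ p) ∧ (∀ i, (p i).im = 0) ∧
      ∀ j, ((toC M *ᵥ p) j).im = 0 := by
  let p : Fin l → ℝ := fun i => (w i).re
  let q : Fin l → ℝ := fun i => (w i).im
  let c : (Fin l → ℝ) → (Fin l → ℂ) := fun a i => (a i : ℂ)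
  have hMc : ∀ a j, (toC M *ᵥ c a) j = (((M *ᵥ a) j : ℝ) : ℂ) := by
    intro a j
    simp [toC, c, Matrix.mulVec, dotProduct]
  have hMw : ∀ j, (toC M *ᵥ w) j = ((M *ᵥ p) j : ℝ) + ((M *ᵥ q) j : ℝ) * Complex.I := by
    intro j
    rw [← hMc, ← hMc]
    simp only [Matrix.mulVec, dotProduct, Finset.sum_mul, ← Finset.sum_add_distrib]
    apply Finset.sum_congr rfl
    intro i _
    simp only [c, p, q]
    conv_lhs => rw [← Complex.re_add_im (w i)]
    ring
  have hsq : ∀ a b : ℝ, ‖(a : ℂ) + b * Complex.I‖ ^ 2 = ‖(a : ℂ)‖ ^ 2 + ‖(b : ℂ)‖ ^ 2 := by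
    intro a b
    rw [Complex.sq_norm, Complex.normSq_add_mul_I]; simp
  have h1 : nrm w ^ 2 = nrm (c p) ^ 2 + nrm (c q) ^ 2 := by
    rw [nrm_sq, nrm_sq, nrm_sq, ← Finset.sum_add_distrib]
    apply Finset.sum_congr rfl
    intro i _
    rw [← hsq, Complex.re_add_im]
  have h2 : nrm (toC M *ᵥ w) ^ 2 = nrm (toC M *ᵥ c p) ^ 2 + nrm (toC M *ᵥ c q) ^ 2 := by
    rw [nrm_sq, nrm_sq, nrm_sq, ← Finset.sum_add_distrib]
    apply Finset.sum_congr rfl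
    intro i _
    rw [hMw, hsq, hMc, hMc]
  by_contra hcon
  push Not at hcon
  have h3 : ∀ a, c a ≠ 0 → nrm (toC M *ᵥ c a) < nrm (c a) := by
    intro a ha
    by_contra hlt
    obtain ⟨j, hj⟩ := hcon (c a) ha (not_lt.mp hlt) (fun i => by simp [c])
    apply hj; rw [hMc]; simp
  have h4 : ∀ a, nrm (toC M *ᵥ c a) ^ 2 ≤ nrm (c a) ^ 2 := by
    intro a
    by_cases ha : c a = 0
    · rw [ha, Matrix.mulVec_zero, nrm_sq, nrm_sq]; simp
    · exact pow_le_pow_left₀ (nrm_nonneg _) (h3 a ha).le 2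
  have h5 : ∀ a, c a ≠ 0 → nrm (toC M *ᵥ c a) ^ 2 < nrm (c a) ^ 2 := fun a ha =>
    pow_lt_pow_left₀ (h3 a ha) (nrm_nonneg _) two_ne_zero
  have h6 := pow_le_pow_left₀ (nrm_nonneg _) hle 2
  have hp : c p = 0 := by
    by_contra h; have := h5 p h; have := h4 q; linarith
  have hq : c q = 0 := by
    by_contra h; have := h5 q h; have := h4 p; linarith
  apply hw0
  funext i
  have hpi := congrFun hp i
  have hqi := congrFun hq i
  rw [← Complex.re_add_im (w i)]
  simp only [c, p, q] at hpi hqi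
  rw [hpi, hqi]; simp

/-- Small gain theorem in state-space form (Theorem A.1 of the paper). -/
theorem small_gain_state_space
    (n nv nw : ℕ)
    (A : Matrix (Fin n) (Fin n) ℝ) (hA : SchurStable A)
    (Bw : Matrix (Fin n) (Fin nw) ℝ)
    (Cv : Matrix (Fin nv) (Fin n) ℝ) (Dvw : Matrix (Fin nv) (Fin nw) ℝ) :
    (∀ θ ∈ Set.Icc (0 : ℝ) (2 * Real.pi),
        sigmaMax (transferFn A Bw Cv Dvw (Complex.exp ((θ : ℂ) * Complex.I))) < 1) ↔
    (∀ (m : ℕ) (AΔ : Matrix (Fin m) (Fin m) ℝ) (BΔ : Matrix (Fin m) (Fin nv) ℝ)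
        (CΔ : Matrix (Fin nw) (Fin m) ℝ) (DΔ : Matrix (Fin nw) (Fin nv) ℝ),
        SchurStable AΔ →
        (∀ θ ∈ Set.Icc (0 : ℝ) (2 * Real.pi),
          sigmaMax (transferFn AΔ BΔ CΔ DΔ (Complex.exp ((θ : ℂ) * Complex.I))) ≤ 1) →
        IsUnit ((1 : Matrix (Fin nv) (Fin nv) ℝ) - Dvw * DΔ) ∧
        SchurStable (interconnectA A Bw Cv Dvw AΔ BΔ CΔ DΔ)) := by
  constructor
  · intro h m AΔ BΔ CΔ DΔ hΔ hD
    exact forward hA Bw Cv Dvw h m AΔ BΔ CΔ DΔ hΔ hD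
  · intro hB θ _
    by_contra hc
    have hz := Complex.norm_exp_ofReal_mul_I θ
    set z := Complex.exp ((θ : ℂ) * Complex.I)
    obtain ⟨w, hw0, hle⟩ := sig_ex _ (not_lt.mp hc)
    by_cases hi : z.im = 0
    · have hzr : z = (z.re : ℂ) := by apply Complex.ext <;> simp [hi]
      obtain ⟨M, hM⟩ := tf_real A Bw Cv Dvw hA z.re (by rw [← hzr, hz])
      rw [← hzr] at hM
      rw [hM] at hle
      obtain ⟨p, hp0, hple, hp1, hp2⟩ := real_split M w hw0 hle
      exact backward hA Bw Cv Dvw hB z hz p hp0 (by rw [hM]; exact hple)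
        (Or.inr ⟨hp1, by rw [hM]; exact hp2⟩)
    · exact backward hA Bw Cv Dvw hB z hz w hw0 hle (Or.inl hi)
end
end
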